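/- Let s, l satisfy s > 3/4, s ≥ l, l > 1/4, 2s − l > 3/4, and 2s + l > 1, and let ε > 0 be sufficiently small. Then for any signs ±, ±₁, ±₂ and all Schwartz A, ψ on ℝ^{1+3} one has the null form estimate ‖B_{±₂,±₁}(A, ψ)‖_{X^{l,−1/4+2ε}_{±}} ≲ ‖A‖_{X^{s,3/4+ε}_{±₂}} ‖ψ‖_{X^{l,3/4+ε}_{±₁}}. -/

import Mathlib

noncomputable section

open MeasureTheory Complex
open scoped FourierTransform RealInnerProductSpace BigOperators

/-! ## Basic setup: space-time `ℝ^{1+3}` and Fourier analytic toolbox -/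

/-- Space-time `ℝ^{1+3}` (used both for physical points `(t,x)` and
Fourier variables `(τ,ξ)`); coordinate `0` is time. -/
abbrev SpaceTime : Type := EuclideanSpace ℝ (Fin 4)

/-- Space `ℝ³`. -/
abbrev Space : Type := EuclideanSpace ℝ (Fin 3)

/-- The spatial part of a space-time point / frequency. -/
def spt (z : SpaceTime) : Space := (WithLp.equiv 2 (Fin 3 → ℝ)).symm fun i => z i.succ

/-- The space-time point `(t, x)`. -/
def stpt (t : ℝ) (x : Space) : SpaceTime :=
  (WithLp.equiv 2 (Fin 4 → ℝ)).symm fun μ => Fin.cases t (fun i => x i) μ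

/-- Japanese bracket `⟨x⟩ = (1+x²)^{1/2}`. -/
def jap (x : ℝ) : ℝ := Real.sqrt (1 + x ^ 2)

/-- The sign `±1` encoded by a boolean (`true ↦ +1`). -/
def sgnv (sg : Bool) : ℝ := if sg then 1 else -1

/-- Minkowski metric coefficient `η^{μμ}`, used to raise indices. -/
def mink (μ : Fin 4) : ℝ := if μ = 0 then -1 else 1

section Ops

variable {E : Type*} [NormedAddCommGroup E] [NormedSpace ℂ E]

/-- Space-time Fourier transform. -/
def FT (u : SpaceTime → E) : SpaceTime → E := fun ζ => 𝓕 u ζ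

/-- Inverse space-time Fourier transform. -/
def FTinv (u : SpaceTime → E) : SpaceTime → E := fun x => 𝓕⁻ u x

/-- Spatial Fourier transform. -/
def FT3 (u : Space → E) : Space → E := fun ξ => 𝓕 u ξ

/-- Inverse spatial Fourier transform. -/
def FT3inv (u : Space → E) : Space → E := fun x => 𝓕⁻ u x

/-- Weighted `L²`-norm (on the Fourier side). -/
def wnorm (w : SpaceTime → ℝ) (f : SpaceTime → E) : ℝ := (∫ ζ, (w ζ * ‖f ζ‖) ^ 2) ^ ((1:ℝ)/2)

/-- Finiteness of the weighted `L²`-norm. -/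
def wfin (w : SpaceTime → ℝ) (f : SpaceTime → E) : Prop :=
  MeasureTheory.HasFiniteIntegral (fun ζ => (w ζ * ‖f ζ‖) ^ 2) volume

/-- The weight of the wave-Sobolev space `H^{s,b}`. -/
def hWt (s b : ℝ) (ζ : SpaceTime) : ℝ := jap ‖spt ζ‖ ^ s * jap (|ζ 0| - ‖spt ζ‖) ^ b

/-- The weight of the space `X^{s,b}_±`. -/
def xWt (sg : Bool) (s b : ℝ) (ζ : SpaceTime) : ℝ :=
  jap ‖spt ζ‖ ^ s * jap (-(ζ 0) + sgnv sg * ‖spt ζ‖) ^ b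

/-- The norm of the wave-Sobolev space `H^{s,b}`:
`‖u‖ = ‖⟨ξ⟩^s ⟨|τ|-|ξ|⟩^b ũ(τ,ξ)‖_{L²}`. -/
def HsbNorm (s b : ℝ) (u : SpaceTime → E) : ℝ := wnorm (hWt s b) (FT u)

/-- Membership (finiteness of the norm) for `H^{s,b}`. -/
def HsbFin (s b : ℝ) (u : SpaceTime → E) : Prop := wfin (hWt s b) (FT u)

/-- The norm of `X^{s,b}_±` : `‖u‖ = ‖⟨ξ⟩^s ⟨-τ ± |ξ|⟩^b ũ(τ,ξ)‖_{L²}`. -/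
def XsbNorm (sg : Bool) (s b : ℝ) (u : SpaceTime → E) : ℝ := wnorm (xWt sg s b) (FT u)

/-- Membership (finiteness of the norm) for `X^{s,b}_±`. -/
def XsbFin (sg : Bool) (s b : ℝ) (u : SpaceTime → E) : Prop := wfin (xWt sg s b) (FT u)

/-- Fourier multiplier with (complex) symbol `m`. -/
def mult (m : SpaceTime → ℂ) (u : SpaceTime → E) : SpaceTime → E := FTinv fun ζ => m ζ • FT u ζ

/-- Fourier multiplier with real symbol `m`. -/
def rmult (m : SpaceTime → ℝ) (u : SpaceTime → E) : SpaceTime → E := mult (fun ζ => (m ζ : ℂ)) u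

/-- `Λ^α`, the multiplier with symbol `⟨ξ⟩^α`. -/
def Lam (α : ℝ) (u : SpaceTime → E) : SpaceTime → E := rmult (fun ζ => jap ‖spt ζ‖ ^ α) u

/-- `Λ₊^α`, the multiplier with symbol `⟨|τ|+|ξ|⟩^α`. -/
def LamPlus (α : ℝ) (u : SpaceTime → E) : SpaceTime → E := rmult (fun ζ => jap (|ζ 0| + ‖spt ζ‖) ^ α) u

/-- `Λ₋^α`, the multiplier with symbol `⟨|τ|-|ξ|⟩^α`. -/
def LamMinus (α : ℝ) (u : SpaceTime → E) : SpaceTime → E := rmult (fun ζ => jap (|ζ 0| - ‖spt ζ‖) ^ α) u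

/-- `D^α`, the multiplier with symbol `|ξ|^α`. -/
def Dop (α : ℝ) (u : SpaceTime → E) : SpaceTime → E := rmult (fun ζ => ‖spt ζ‖ ^ α) u

/-- `D₊^α`, the multiplier with symbol `(|τ|+|ξ|)^α`. -/
def DPlus (α : ℝ) (u : SpaceTime → E) : SpaceTime → E := rmult (fun ζ => (|ζ 0| + ‖spt ζ‖) ^ α) u

/-- `D₋^α`, the multiplier with symbol `||τ|-|ξ||^α`. -/
def DMinus (α : ℝ) (u : SpaceTime → E) : SpaceTime → E := rmult (fun ζ => |(|ζ 0| - ‖spt ζ‖)| ^ α) u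

/-- `|∇|`, the multiplier with symbol `|ξ|`. -/
def absNabla (u : SpaceTime → E) : SpaceTime → E := Dop 1 u

/-- The partial derivative `∂_μ` on space-time. -/
def pd (μ : Fin 4) (u : SpaceTime → E) : SpaceTime → E := fun x => fderiv ℝ u x (EuclideanSpace.single μ 1)

/-- The spatial partial derivative `∂_i` on `ℝ³`. -/
def pd3 (i : Fin 3) (u : Space → E) : Space → E := fun x => fderiv ℝ u x (EuclideanSpace.single i 1)

/-- The (inhomogeneous) Riesz transform `R_j = Λ^{-1} ∂_j`. -/
def Riesz (j : Fin 3) (u : SpaceTime → E) : SpaceTime → E := Lam (-1) (pd j.succ u)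

/-- The d'Alembertian `□ = ∂_t² - Δ`. -/
def box (u : SpaceTime → E) : SpaceTime → E :=
  fun x => pd 0 (pd 0 u) x - ∑ j : Fin 3, pd j.succ (pd j.succ u) x

/-- The `F^s` norm, `‖u‖_{F^s} = ‖Λ₊ u‖_{H^{s-1,3/4+ε}}`. -/
def FsNorm (ε s : ℝ) (u : SpaceTime → E) : ℝ := HsbNorm (s - 1) (3/4 + ε) (LamPlus 1 u)

/-- Membership in `F^s`. -/
def FsFin (ε s : ℝ) (u : SpaceTime → E) : Prop := HsbFin (s - 1) (3/4 + ε) (LamPlus 1 u)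

/-- The `G^r` norm, `‖v‖_{G^r} = ‖Λ₊ v‖_{H^{r-1,1/2+ε}}`. -/
def GrNorm (ε r : ℝ) (v : SpaceTime → E) : ℝ := HsbNorm (r - 1) (1/2 + ε) (LamPlus 1 v)

/-- Membership in `G^r`. -/
def GrFin (ε r : ℝ) (v : SpaceTime → E) : Prop := HsbFin (r - 1) (1/2 + ε) (LamPlus 1 v)

/-- The time slab `[0,T] × ℝ³`. -/
def slab (T : ℝ) : Set SpaceTime := {x | x 0 ∈ Set.Icc 0 T}

/-- `u` belongs to the restriction to `[0,T]` of the space with defining predicate `P`: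
it has an extension lying in that space. -/
def MemRestrict (P : (SpaceTime → E) → Prop) (T : ℝ) (u : SpaceTime → E) : Prop :=
  ∃ U : SpaceTime → E, P U ∧ Set.EqOn U u (slab T)

/-- The spatial Sobolev `H^s(ℝ³)` norm. -/
def HNorm (s : ℝ) (f : Space → E) : ℝ :=
  (∫ ξ, (jap ‖ξ‖ ^ s * ‖FT3 f ξ‖) ^ 2) ^ ((1:ℝ)/2)

/-- Membership in the spatial Sobolev space `H^s(ℝ³)`. -/
def MemHs (s : ℝ) (f : Space → E) : Prop :=
  MeasureTheory.HasFiniteIntegral (fun ξ => (jap ‖ξ‖ ^ s * ‖FT3 f ξ‖) ^ 2) volume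

/-- Continuity with values in `H^s` on the time interval `[0,T]` (for a space-time function). -/
def ContHsOn (s T : ℝ) (u : SpaceTime → E) : Prop :=
  (∀ t ∈ Set.Icc (0:ℝ) T, MemHs s fun ξ => u (stpt t ξ)) ∧
  ∀ t ∈ Set.Icc (0:ℝ) T,
    Filter.Tendsto (fun t' => HNorm s fun ξ => u (stpt t' ξ) - u (stpt t ξ))
      (nhdsWithin t (Set.Icc 0 T)) (nhds 0)

end Ops

/-- The angle weight `|∠(±₁ξ₁, ±₂ξ₂)|`. -/
def angleWt (sg1 sg2 : Bool) (η θ : SpaceTime) : ℝ :=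
  |InnerProductGeometry.angle (sgnv sg1 • spt η) (sgnv sg2 • spt θ)|

/-- The bilinear null-form operator `B_{±₁,±₂}`, defined by its space-time Fourier transform
`𝓕(B(u,v))(ζ) = ∫ |∠(±₁ξ₁, ±₂ξ₂)| ũ(ζ₁) ṽ(ζ-ζ₁) dζ₁`. -/
def Bop (sg1 sg2 : Bool) (u v : SpaceTime → ℂ) : SpaceTime → ℂ :=
  FTinv fun ζ => ∫ η, (angleWt sg1 sg2 η (ζ - η) : ℂ) * FT u η * FT v (ζ - η)

/-! ## Null forms -/

/-- The null form `Q₀(u,v) = ∂_α u ∂^α v`. -/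
def Q0f (u v : SpaceTime → ℂ) : SpaceTime → ℂ := fun x => ∑ μ : Fin 4, mink μ • (pd μ u x * pd μ v x)

/-- The null form `Q_{αβ}(u,v) = ∂_α u ∂_β v - ∂_β u ∂_α v`. -/
def Qf (α β : Fin 4) (u v : SpaceTime → ℂ) : SpaceTime → ℂ :=
  fun x => pd α u x * pd β v x - pd β u x * pd α v x

/-! ## Matrix-valued (Lie algebra) objects -/

/-- `n×n` complex matrices, the ambient space of `su(n,ℂ)`. -/
abbrev G (n : ℕ) : Type := Matrix (Fin n) (Fin n) ℂ

attribute [local instance] Matrix.frobeniusNormedAddCommGroup Matrix.frobeniusNormedSpace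

/-- Membership in the Lie algebra `su(n,ℂ)` (trace-free skew-hermitian matrices). -/
def IsSu {n : ℕ} (X : G n) : Prop := X.conjTranspose = -X ∧ X.trace = 0

/-- The matrix commutator `[X,Y] = XY - YX`. -/
def mcomm {n : ℕ} (X Y : G n) : G n := X * Y - Y * X

/-- The commutator null form `Q_{αβ}[u,v] = [∂_α u, ∂_β v] - [∂_β u, ∂_α v]`. -/
def Qc {n : ℕ} (α β : Fin 4) (u v : SpaceTime → G n) : SpaceTime → G n :=
  fun x => mcomm (pd α u x) (pd β v x) - mcomm (pd β u x) (pd α v x)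

/-- The commutator null form `Q₀[u,v] = [∂_α u, ∂^α v]`. -/
def Q0c {n : ℕ} (u v : SpaceTime → G n) : SpaceTime → G n :=
  fun x => ∑ μ : Fin 4, mink μ • mcomm (pd μ u x) (pd μ v x)

/-! ## Dirac operators -/

/-- The spinor space `ℂ⁴`. -/
abbrev C4 : Type := EuclideanSpace ℂ (Fin 4)

/-- A `4×4` matrix acting on `ℂ⁴`. -/
def matAct (M : Matrix (Fin 4) (Fin 4) ℂ) (v : C4) : C4 :=
  (WithLp.equiv 2 (Fin 4 → ℂ)).symm (M.mulVec ((WithLp.equiv 2 (Fin 4 → ℂ)) v))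

/-- The Dirac matrices `α^0 = I`, `α^j = ((0,σ^j),(σ^j,0))`. -/
def alphaMat : Fin 4 → Matrix (Fin 4) (Fin 4) ℂ
  | 0 => 1
  | 1 => !![0,0,0,1; 0,0,1,0; 0,1,0,0; 1,0,0,0]
  | 2 => !![0,0,0,-I; 0,0,I,0; 0,-I,0,0; I,0,0,0]
  | 3 => !![0,0,1,0; 0,0,0,-1; 1,0,0,0; 0,-1,0,0]

/-- Matrix-symbol Fourier multiplier on spinor fields (space-time). -/
def multM (m : SpaceTime → Matrix (Fin 4) (Fin 4) ℂ) (u : SpaceTime → C4) : SpaceTime → C4 :=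
  FTinv fun ζ => matAct (m ζ) (FT u ζ)

/-- Matrix-symbol Fourier multiplier on spinor fields (space). -/
def multM3 (m : Space → Matrix (Fin 4) (Fin 4) ℂ) (u : Space → C4) : Space → C4 :=
  FT3inv fun ξ => matAct (m ξ) (FT3 u ξ)

/-- The symbol `Π(±ξ) = ½(I ± ξ_j α^j / |ξ|)` of the Dirac projections. -/
def PiSymb (sg : Bool) (ξ : Space) : Matrix (Fin 4) (Fin 4) ℂ :=
  (2⁻¹ : ℂ) • (1 + ∑ j : Fin 3, ((sgnv sg * ξ j / ‖ξ‖ : ℝ) : ℂ) • alphaMat j.succ)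

/-- The Dirac projection `Π_± = Π_±(∇/i)` (space-time version). -/
def PiProj (sg : Bool) (u : SpaceTime → C4) : SpaceTime → C4 := multM (fun ζ => PiSymb sg (spt ζ)) u

/-- The Dirac projection `Π_± = Π_±(∇/i)` acting on functions of the space variable. -/
def PiProj3 (sg : Bool) (u : Space → C4) : Space → C4 := multM3 (fun ξ => PiSymb sg ξ) u

/-! ## Japanese brackets -/

lemma one_le_jap (x : ℝ) : 1 ≤ jap x :=
  Real.one_le_sqrt.mpr (by nlinarith [sq_nonneg x])

lemma jap_pos (x : ℝ) : 0 < jap x := one_pos.trans_le (one_le_jap x)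

lemma abs_le_jap (x : ℝ) : |x| ≤ jap x :=
  Real.abs_le_sqrt (by linarith)

lemma jap_le_one_add_abs (x : ℝ) : jap x ≤ 1 + |x| := by
  rw [jap, Real.sqrt_le_left (by positivity)]
  nlinarith [abs_nonneg x, sq_abs x]

lemma jap_le_jap {x y : ℝ} (h : |x| ≤ |y|) : jap x ≤ jap y :=
  Real.sqrt_le_sqrt (by linarith [sq_le_sq.mpr h])

lemma jap_add_le (x y : ℝ) : jap (x + y) ≤ jap x + jap y := by
  have hx := one_le_jap x
  have hy := one_le_jap y
  rw [jap, Real.sqrt_le_left (by linarith)]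
  have h1 : jap x ^ 2 = 1 + x ^ 2 := Real.sq_sqrt (by positivity)
  have h2 : jap y ^ 2 = 1 + y ^ 2 := Real.sq_sqrt (by positivity)
  have h3 : x * y ≤ jap x * jap y := by
    calc x * y ≤ |x| * |y| := by rw [← abs_mul]; exact le_abs_self _
      _ ≤ jap x * jap y := by gcongr <;> exact abs_le_jap _
  nlinarith

lemma continuous_jap : Continuous jap := by unfold jap; fun_prop

@[fun_prop]
lemma measurable_jap : Measurable jap := continuous_jap.measurable

lemma jap_min {p q : ℝ} (hp : 0 ≤ p) (hq : 0 ≤ q) : jap (min p q) = min (jap p) (jap q) := by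
  rcases le_total p q with h | h
  · rw [min_eq_left h, min_eq_left (jap_le_jap (by rwa [abs_of_nonneg hp, abs_of_nonneg hq]))]
  · rw [min_eq_right h, min_eq_right (jap_le_jap (by rwa [abs_of_nonneg hp, abs_of_nonneg hq]))]

lemma sgnv_mul_self (e : Bool) : sgnv e * sgnv e = 1 := by cases e <;> simp [sgnv]

lemma abs_sgnv (e : Bool) : |sgnv e| = 1 := by cases e <;> simp [sgnv]

lemma sgnv_ne_zero (e : Bool) : sgnv e ≠ 0 := by cases e <;> simp [sgnv]

/-! ## Angles -/

section Angle

variable {V : Type*} [NormedAddCommGroup V] [InnerProductSpace ℝ V]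

lemma angle_sq_le (x y : V) :
    InnerProductGeometry.angle x y ^ 2 ≤
      Real.pi ^ 2 / 2 * (1 - Real.cos (InnerProductGeometry.angle x y)) := by
  have h := Real.cos_le_one_sub_mul_cos_sq (x := InnerProductGeometry.angle x y)
    (by rw [abs_of_nonneg (InnerProductGeometry.angle_nonneg x y)]
        exact InnerProductGeometry.angle_le_pi x y)
  have h2 : 2 / Real.pi ^ 2 * InnerProductGeometry.angle x y ^ 2 ≤
      1 - Real.cos (InnerProductGeometry.angle x y) := by linarith
  calc _ = Real.pi ^ 2 / 2 * (2 / Real.pi ^ 2 * InnerProductGeometry.angle x y ^ 2) := by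
        field_simp
    _ ≤ _ := by gcongr

lemma norm_sgnv_smul (e : Bool) (x : V) : ‖sgnv e • x‖ = ‖x‖ := by
  rw [norm_smul, Real.norm_eq_abs, abs_sgnv, one_mul]

lemma norm_add_sq_eq_cos_angle (e₁ e₂ : Bool) (x y : V) :
    ‖x + y‖ ^ 2 = ‖x‖ ^ 2 + ‖y‖ ^ 2 + 2 * (sgnv e₁ * sgnv e₂) *
      (‖x‖ * ‖y‖ * Real.cos (InnerProductGeometry.angle (sgnv e₁ • x) (sgnv e₂ • y))) := by
  have h := InnerProductGeometry.cos_angle_mul_norm_mul_norm (sgnv e₁ • x) (sgnv e₂ • y)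
  rw [norm_sgnv_smul, norm_sgnv_smul, real_inner_smul_left, real_inner_smul_right] at h
  rw [norm_add_sq_real]
  linear_combination (-2 * sgnv e₁ * sgnv e₂) * h - 2 * ⟪x, y⟫ * (sgnv e₁ * sgnv e₁) *
    sgnv_mul_self e₂ - 2 * ⟪x, y⟫ * sgnv_mul_self e₁

/-- If the signs are opposite, the angle between the signed summands of `x + y` is
controlled by the size of the sum. -/
lemma angle_mul_norm_le {e₁ e₂ : Bool} (he : e₁ ≠ e₂) (x y : V) :
    InnerProductGeometry.angle (sgnv e₁ • x) (sgnv e₂ • y) * ‖y‖ ≤ 2 * Real.pi * ‖x + y‖ := by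
  have h := norm_add_sq_eq_cos_angle e₁ e₂ x y
  have hs : sgnv e₁ * sgnv e₂ = -1 := by cases e₁ <;> cases e₂ <;> simp_all [sgnv]
  have ha := angle_sq_le (sgnv e₁ • x) (sgnv e₂ • y)
  have hc := Real.cos_le_one (InnerProductGeometry.angle (sgnv e₁ • x) (sgnv e₂ • y))
  have hp := InnerProductGeometry.angle_le_pi (sgnv e₁ • x) (sgnv e₂ • y)
  have hn := InnerProductGeometry.angle_nonneg (sgnv e₁ • x) (sgnv e₂ • y)
  rw [hs] at h
  have hpi := Real.pi_pos
  generalize InnerProductGeometry.angle (sgnv e₁ • x) (sgnv e₂ • y) = θ at *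
  have hx := norm_nonneg x
  have hy := norm_nonneg y
  have hxy := norm_nonneg (x + y)
  rcases le_total (‖y‖ / 2) ‖x‖ with h2 | h2
  · apply le_of_sq_le_sq _ (by positivity)
    have h3 : ‖y‖ ^ 2 * (1 - Real.cos θ) ≤ ‖x + y‖ ^ 2 := by
      have : 0 ≤ (2 * ‖x‖ - ‖y‖) * ‖y‖ * (1 - Real.cos θ) := by
        apply mul_nonneg (mul_nonneg _ hy) <;> linarith
      nlinarith [sq_nonneg (‖x‖ - ‖y‖)]
    calc (θ * ‖y‖) ^ 2 = θ ^ 2 * ‖y‖ ^ 2 := by ring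
      _ ≤ (Real.pi ^ 2 / 2 * (1 - Real.cos θ)) * ‖y‖ ^ 2 := by gcongr
      _ = Real.pi ^ 2 / 2 * (‖y‖ ^ 2 * (1 - Real.cos θ)) := by ring
      _ ≤ Real.pi ^ 2 / 2 * ‖x + y‖ ^ 2 := by gcongr
      _ ≤ (2 * Real.pi * ‖x + y‖) ^ 2 := by
        nlinarith [mul_nonneg (sq_nonneg Real.pi) (sq_nonneg ‖x + y‖)]
  · have h3 : ‖y‖ ≤ 2 * ‖x + y‖ := by
      have := norm_sub_norm_le y (-x)
      rw [norm_neg, sub_neg_eq_add, add_comm y x] at this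
      linarith
    calc θ * ‖y‖ ≤ Real.pi * (2 * ‖x + y‖) := by gcongr
      _ = _ := by ring

/-- The resonance identity: the angle is controlled by the distances to the light cones. -/
lemma angle_sq_mul_min_le (e₀ e₁ e₂ : Bool) (t t₁ : ℝ) (x y : V) :
    InnerProductGeometry.angle (sgnv e₁ • x) (sgnv e₂ • y) ^ 2 * min ‖x‖ ‖y‖ ≤
      Real.pi ^ 2 * (|-t + sgnv e₀ * ‖x + y‖| + |-t₁ + sgnv e₁ * ‖x‖| +
        |-(t - t₁) + sgnv e₂ * ‖y‖|) := by
  have h := norm_add_sq_eq_cos_angle e₁ e₂ x y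
  have ha := angle_sq_le (sgnv e₁ • x) (sgnv e₂ • y)
  have hc := Real.cos_le_one (InnerProductGeometry.angle (sgnv e₁ • x) (sgnv e₂ • y))
  generalize InnerProductGeometry.angle (sgnv e₁ • x) (sgnv e₂ • y) = θ at *
  have hx := norm_nonneg x
  have hy := norm_nonneg y
  have hN := norm_nonneg (x + y)
  have hle := norm_add_le x y
  have hsum : min ‖x‖ ‖y‖ * (‖x‖ + ‖y‖) ≤ 2 * (‖x‖ * ‖y‖) := by
    rcases le_total ‖x‖ ‖y‖ with h2 | h2
    · rw [min_eq_left h2]; nlinarith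
    · rw [min_eq_right h2]; nlinarith
  have hm : 0 ≤ min ‖x‖ ‖y‖ := le_min hx hy
  set S := |-t + sgnv e₀ * ‖x + y‖| + |-t₁ + sgnv e₁ * ‖x‖| + |-(t - t₁) + sgnv e₂ * ‖y‖|
    with hS
  have hS0 : 0 ≤ S := by positivity
  have key : min ‖x‖ ‖y‖ * (1 - Real.cos θ) ≤ 2 * S := by
    rcases (add_nonneg hx hy).eq_or_lt with h0 | h0
    · have : min ‖x‖ ‖y‖ = 0 := le_antisymm ((min_le_left _ _).trans (by linarith)) hm
      rw [this]; linarith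
    refine le_of_mul_le_mul_right ?_ h0
    have h1 : min ‖x‖ ‖y‖ * (1 - Real.cos θ) * (‖x‖ + ‖y‖) ≤
        2 * (‖x‖ * ‖y‖ * (1 - Real.cos θ)) := by nlinarith
    refine h1.trans ?_
    have hb0 := abs_le.mp (le_refl |-t + sgnv e₀ * ‖x + y‖|)
    have hb1 := abs_le.mp (le_refl |-t₁ + sgnv e₁ * ‖x‖|)
    have hb2 := abs_le.mp (le_refl |-(t - t₁) + sgnv e₂ * ‖y‖|)
    set a₀ := |-t + sgnv e₀ * ‖x + y‖|
    set a₁ := |-t₁ + sgnv e₁ * ‖x‖|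
    set a₂ := |-(t - t₁) + sgnv e₂ * ‖y‖|
    set d := ‖x‖ * ‖y‖ * (1 - Real.cos θ) with hd
    have hcd : ‖x‖ * ‖y‖ * Real.cos θ = ‖x‖ * ‖y‖ - d := by rw [hd]; ring
    rw [hcd] at h
    have same (hs : ‖x + y‖ ^ 2 = ‖x‖ ^ 2 + ‖y‖ ^ 2 + 2 * (‖x‖ * ‖y‖ - d))
        (hk : ‖x‖ + ‖y‖ - ‖x + y‖ ≤ S) : 2 * d ≤ 2 * S * (‖x‖ + ‖y‖) := by
      nlinarith
    have opp (hs : ‖x + y‖ ^ 2 = ‖x‖ ^ 2 + ‖y‖ ^ 2 - 2 * (‖x‖ * ‖y‖ - d))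
        (hk1 : ‖x + y‖ - (‖x‖ - ‖y‖) ≤ S ∨ ‖x + y‖ + (‖x‖ - ‖y‖) ≤ S) :
        2 * d ≤ 2 * S * (‖x‖ + ‖y‖) := by
      have t1 : ‖x‖ ≤ ‖x + y‖ + ‖y‖ := by simpa using norm_sub_le (x + y) y
      have t2 : ‖y‖ ≤ ‖x + y‖ + ‖x‖ := by simpa using norm_sub_le (x + y) x
      have hd2 : 2 * d = (‖x + y‖ - (‖x‖ - ‖y‖)) * (‖x + y‖ + (‖x‖ - ‖y‖)) := by
        linear_combination -hs
      rcases hk1 with hk | hk <;> nlinarith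
    cases e₁ <;> cases e₂ <;> cases e₀ <;>
      simp only [sgnv, if_true, Bool.false_eq_true, if_false] at h hb0 hb1 hb2
    · exact same (by linarith) (by linarith)
    · exact same (by linarith) (by linarith)
    · exact opp (by linarith) (by by_contra hh; push Not at hh; linarith)
    · exact opp (by linarith) (by by_contra hh; push Not at hh; linarith)
    · exact opp (by linarith) (by by_contra hh; push Not at hh; linarith)
    · exact opp (by linarith) (by by_contra hh; push Not at hh; linarith)
    · exact same (by linarith) (by linarith)
    · exact same (by linarith) (by linarith)
  calc θ ^ 2 * min ‖x‖ ‖y‖ ≤ (Real.pi ^ 2 / 2 * (1 - Real.cos θ)) * min ‖x‖ ‖y‖ := by gcongr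
    _ = Real.pi ^ 2 / 2 * (min ‖x‖ ‖y‖ * (1 - Real.cos θ)) := by ring
    _ ≤ Real.pi ^ 2 / 2 * (2 * S) := by gcongr
    _ = Real.pi ^ 2 * S := by ring

lemma angle_sq_mul_jap_le (e₀ e₁ e₂ : Bool) (t t₁ : ℝ) (x y : V) :
    InnerProductGeometry.angle (sgnv e₁ • x) (sgnv e₂ • y) ^ 2 * jap (min ‖x‖ ‖y‖) ≤
      6 * Real.pi ^ 2 * (jap (-t + sgnv e₀ * ‖x + y‖) * jap (-t₁ + sgnv e₁ * ‖x‖) *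
        jap (-(t - t₁) + sgnv e₂ * ‖y‖)) := by
  have h := angle_sq_mul_min_le e₀ e₁ e₂ t t₁ x y
  have hp := InnerProductGeometry.angle_le_pi (sgnv e₁ • x) (sgnv e₂ • y)
  have hn := InnerProductGeometry.angle_nonneg (sgnv e₁ • x) (sgnv e₂ • y)
  have hj := jap_le_one_add_abs (min ‖x‖ ‖y‖)
  rw [abs_of_nonneg (le_min (norm_nonneg x) (norm_nonneg y))] at hj
  have h0 := abs_le_jap (-t + sgnv e₀ * ‖x + y‖)
  have h1 := abs_le_jap (-t₁ + sgnv e₁ * ‖x‖)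
  have h2 := abs_le_jap (-(t - t₁) + sgnv e₂ * ‖y‖)
  have g0 := one_le_jap (-t + sgnv e₀ * ‖x + y‖)
  have g1 := one_le_jap (-t₁ + sgnv e₁ * ‖x‖)
  have g2 := one_le_jap (-(t - t₁) + sgnv e₂ * ‖y‖)
  generalize InnerProductGeometry.angle (sgnv e₁ • x) (sgnv e₂ • y) = θ at *
  generalize jap (-t + sgnv e₀ * ‖x + y‖) = S₀ at *
  generalize jap (-t₁ + sgnv e₁ * ‖x‖) = S₁ at *
  generalize jap (-(t - t₁) + sgnv e₂ * ‖y‖) = S₂ at *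
  have a01 : S₀ ≤ S₀ * S₁ * S₂ := by
    have := mul_nonneg (by linarith : 0 ≤ S₀) (by nlinarith : 0 ≤ S₁ * S₂ - 1); linarith
  have a02 : S₁ ≤ S₀ * S₁ * S₂ := by
    have := mul_nonneg (by linarith : 0 ≤ S₁) (by nlinarith : 0 ≤ S₀ * S₂ - 1); linarith
  have a03 : S₂ ≤ S₀ * S₁ * S₂ := by
    have := mul_nonneg (by linarith : 0 ≤ S₂) (by nlinarith : 0 ≤ S₀ * S₁ - 1); linarith
  have hpi := sq_nonneg Real.pi
  calc θ ^ 2 * jap (min ‖x‖ ‖y‖) ≤ θ ^ 2 * (1 + min ‖x‖ ‖y‖) := by gcongr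
    _ = θ ^ 2 + θ ^ 2 * min ‖x‖ ‖y‖ := by ring
    _ ≤ Real.pi ^ 2 + Real.pi ^ 2 * (|-t + sgnv e₀ * ‖x + y‖| + |-t₁ + sgnv e₁ * ‖x‖| +
        |-(t - t₁) + sgnv e₂ * ‖y‖|) := by gcongr
    _ = Real.pi ^ 2 * (1 + (|-t + sgnv e₀ * ‖x + y‖| + |-t₁ + sgnv e₁ * ‖x‖| +
        |-(t - t₁) + sgnv e₂ * ‖y‖|)) := by ring
    _ ≤ Real.pi ^ 2 * (6 * (S₀ * S₁ * S₂)) := by gcongr; linarith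
    _ = _ := by ring

end Angle

/-! ## Splitting off coordinates -/

lemma measurePreserving_head_tail (n : ℕ) :
    MeasurePreserving (fun v : EuclideanSpace ℝ (Fin (n + 1)) =>
      ((v 0, fun i : Fin n => v i.succ) : ℝ × (Fin n → ℝ))) := by
  have h := (volume_preserving_piFinSuccAbove (fun _ : Fin (n + 1) => ℝ) 0).comp
    (PiLp.volume_preserving_ofLp (Fin (n + 1)))
  exact h

lemma measurePreserving_time_spt :
    MeasurePreserving (fun η : SpaceTime => (η 0, spt η)) :=
  ((MeasurePreserving.id (volume : Measure ℝ)).prod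
    (PiLp.volume_preserving_toLp (Fin 3))).comp (measurePreserving_head_tail 3)

lemma lintegral_spaceTime {G : ℝ × Space → ENNReal} (hG : Measurable G) :
    ∫⁻ η : SpaceTime, G (η 0, spt η) = ∫⁻ ξ : Space, ∫⁻ τ : ℝ, G (τ, ξ) := by
  rw [measurePreserving_time_spt.lintegral_comp hG, Measure.volume_eq_prod,
    lintegral_prod_symm' _ hG]

lemma measurable_spt : Measurable spt :=
  measurable_snd.comp measurePreserving_time_spt.measurable

lemma lintegral_cylindrical {e : Space} (he : ‖e‖ = 1) {G : ℝ × ℝ → ENNReal}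
    (hG : Measurable G) :
    ∫⁻ ξ : Space, G (⟪e, ξ⟫, ‖ξ‖) =
      ∫⁻ z : ℝ, ∫⁻ p : ℝ × ℝ, G (z, √(z ^ 2 + (p.1 ^ 2 + p.2 ^ 2))) := by
  obtain ⟨b, hb⟩ := Orthonormal.exists_orthonormalBasis_extension_of_card_eq (𝕜 := ℝ)
    (E := Space) (ι := Fin 3) (by simp) (v := fun _ => e) (s := {0})
    ⟨fun i => by simp [he], fun i j hij => (hij (Subsingleton.elim _ _)).elim⟩
  have hb0 : b 0 = e := hb 0 rfl
  have hT : MeasurePreserving (fun ξ : Space =>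
      ((b.repr ξ 0, (b.repr ξ 1, b.repr ξ 2)) : ℝ × (ℝ × ℝ))) := by
    have := (((MeasurePreserving.id (volume : Measure ℝ)).prod
      (volume_preserving_finTwoArrow ℝ)).comp (measurePreserving_head_tail 2)).comp
        b.measurePreserving_repr
    exact this
  have hG' : Measurable fun q : ℝ × (ℝ × ℝ) =>
      G (q.1, √(q.1 ^ 2 + (q.2.1 ^ 2 + q.2.2 ^ 2))) := by fun_prop
  have h := hT.lintegral_comp hG'
  rw [Measure.volume_eq_prod ℝ (ℝ × ℝ), lintegral_prod _ hG'.aemeasurable] at h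
  rw [← h]
  refine lintegral_congr fun ξ => ?_
  have h1 : ⟪e, ξ⟫ = b.repr ξ 0 := by rw [← hb0, b.repr_apply_apply]
  have h2 : ‖ξ‖ = √((b.repr ξ 0) ^ 2 + ((b.repr ξ 1) ^ 2 + (b.repr ξ 2) ^ 2)) := by
    rw [← b.repr.norm_map ξ, EuclideanSpace.norm_eq, Fin.sum_univ_three]
    simp [add_assoc]
  rw [← h1] at h2 ⊢
  rw [← h2]

lemma lintegral_radial {g : ℝ → ENNReal} (hg : Measurable g) :
    ∫⁻ p : ℝ × ℝ, g (p.1 ^ 2 + p.2 ^ 2) =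
      ENNReal.ofReal (2 * Real.pi) * ∫⁻ R in Set.Ioi (0 : ℝ), ENNReal.ofReal R * g (R ^ 2) := by
  rw [← lintegral_comp_polarCoord_symm, polarCoord_target, Measure.volume_eq_prod,
    ← Measure.prod_restrict, lintegral_prod_symm']
  · have : ∀ y x : ℝ, ENNReal.ofReal (x, y).1 • g ((polarCoord.symm (x, y)).1 ^ 2 +
        (polarCoord.symm (x, y)).2 ^ 2) = ENNReal.ofReal x * g (x ^ 2) := by
      intro y x
      rw [polarCoord_symm_apply, smul_eq_mul]
      congr 2
      linear_combination x ^ 2 * Real.sin_sq_add_cos_sq y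
    simp_rw [this]
    rw [setLIntegral_const, Real.volume_Ioo, mul_comm]
    congr 2
    ring
  · have : Measurable (polarCoord.symm : ℝ × ℝ → ℝ × ℝ) := by
      have h : (polarCoord.symm : ℝ × ℝ → ℝ × ℝ) =
          fun p => (p.1 * Real.cos p.2, p.1 * Real.sin p.2) := by
        ext p <;> simp [polarCoord_symm_apply]
      rw [h]; fun_prop
    simp only [smul_eq_mul]
    fun_prop

lemma lintegral_mul_comp_sqrt_add_sq (z : ℝ) (g : ℝ → ENNReal) :
    ∫⁻ R in Set.Ioi (0 : ℝ), ENNReal.ofReal R * g √(z ^ 2 + R ^ 2) =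
      ∫⁻ r in Set.Ioi |z|, ENNReal.ofReal r * g r := by
  have hpos : ∀ R ∈ Set.Ioi (0 : ℝ), 0 < z ^ 2 + R ^ 2 := fun R hR => by
    have : 0 < R := hR
    positivity
  have himg : (fun R => √(z ^ 2 + R ^ 2)) '' Set.Ioi 0 = Set.Ioi |z| := by
    ext r
    constructor
    · rintro ⟨R, hR, rfl⟩
      have hR' : 0 < R := hR
      exact Real.lt_sqrt_of_sq_lt (by rw [sq_abs]; nlinarith)
    · intro hr
      have hr' : |z| < r := hr
      have h0 : 0 < r := (abs_nonneg z).trans_lt hr'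
      have h1 : 0 < r ^ 2 - z ^ 2 := by
        have := sq_lt_sq' (by linarith [abs_nonneg z]) hr'
        rw [sq_abs] at this; linarith
      refine ⟨√(r ^ 2 - z ^ 2), Real.sqrt_pos.mpr h1, ?_⟩
      simp only
      rw [Real.sq_sqrt h1.le, add_sub_cancel, Real.sqrt_sq h0.le]
  have hd : ∀ R ∈ Set.Ioi (0 : ℝ), HasDerivWithinAt (fun R => √(z ^ 2 + R ^ 2))
      (R / √(z ^ 2 + R ^ 2)) (Set.Ioi 0) R := by
    intro R hR
    have h := ((hasDerivAt_pow 2 R).const_add (z ^ 2)).sqrt (hpos R hR).ne'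
    refine (h.congr_deriv ?_).hasDerivWithinAt
    have hs := Real.sqrt_pos.mpr (hpos R hR)
    simp
    field_simp
  have hinj : Set.InjOn (fun R => √(z ^ 2 + R ^ 2)) (Set.Ioi 0) := by
    intro R hR R' hR' h
    have h2 := (Real.sqrt_inj (hpos R hR).le (hpos R' hR').le).mp h
    exact (pow_left_inj₀ (le_of_lt hR) (le_of_lt hR') two_ne_zero).mp (by linarith)
  rw [← himg, lintegral_image_eq_lintegral_abs_deriv_mul measurableSet_Ioi hd hinj]
  refine setLIntegral_congr_fun measurableSet_Ioi fun R hR => ?_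
  have hs := Real.sqrt_pos.mpr (hpos R hR)
  have hR' : 0 < R := hR
  rw [← mul_assoc, ← ENNReal.ofReal_mul (abs_nonneg _), abs_of_pos (by positivity),
    div_mul_cancel₀ _ hs.ne']

lemma lintegral_axial {r r₀ : ℝ} (hr₀ : 0 < r₀) (g : ℝ → ENNReal) :
    ∫⁻ z in Set.Iio ((r ^ 2 + r₀ ^ 2) / (2 * r₀)), g √(r ^ 2 + r₀ ^ 2 - 2 * r₀ * z) =
      ∫⁻ ρ in Set.Ioi (0 : ℝ), ENNReal.ofReal (ρ / r₀) * g ρ := by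
  have himg : (fun ρ => (r ^ 2 + r₀ ^ 2 - ρ ^ 2) / (2 * r₀)) '' Set.Ioi 0 =
      Set.Iio ((r ^ 2 + r₀ ^ 2) / (2 * r₀)) := by
    ext z
    constructor
    · rintro ⟨ρ, hρ, rfl⟩
      have hρ' : 0 < ρ := hρ
      refine div_lt_div_of_pos_right (?_ : r ^ 2 + r₀ ^ 2 - ρ ^ 2 < r ^ 2 + r₀ ^ 2) (by positivity)
      nlinarith
    · intro hz
      have h1 : 0 < r ^ 2 + r₀ ^ 2 - 2 * r₀ * z := by
        have := (lt_div_iff₀ (by positivity)).mp (Set.mem_Iio.mp hz)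
        linarith
      refine ⟨√(r ^ 2 + r₀ ^ 2 - 2 * r₀ * z), Real.sqrt_pos.mpr h1, ?_⟩
      simp only
      rw [Real.sq_sqrt h1.le]
      field_simp
      ring
  have hd : ∀ ρ ∈ Set.Ioi (0 : ℝ), HasDerivWithinAt
      (fun ρ => (r ^ 2 + r₀ ^ 2 - ρ ^ 2) / (2 * r₀)) (-(ρ / r₀)) (Set.Ioi 0) ρ := by
    intro ρ hρ
    have h := ((hasDerivAt_pow 2 ρ).const_sub (r ^ 2 + r₀ ^ 2)).div_const (2 * r₀)
    refine (h.congr_deriv ?_).hasDerivWithinAt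
    simp
    field_simp
  have hinj : Set.InjOn (fun ρ => (r ^ 2 + r₀ ^ 2 - ρ ^ 2) / (2 * r₀)) (Set.Ioi 0) := by
    intro ρ hρ ρ' hρ' h
    have h2 := (div_left_inj' (by positivity)).mp h
    exact (pow_left_inj₀ (le_of_lt hρ) (le_of_lt hρ') two_ne_zero).mp (by linarith)
  rw [← himg, lintegral_image_eq_lintegral_abs_deriv_mul measurableSet_Ioi hd hinj]
  refine setLIntegral_congr_fun measurableSet_Ioi fun ρ hρ => ?_
  have hρpos : 0 < ρ := hρ
  rw [abs_neg, abs_of_pos (by positivity)]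
  congr 2
  rw [show r ^ 2 + r₀ ^ 2 - 2 * r₀ * ((r ^ 2 + r₀ ^ 2 - ρ ^ 2) / (2 * r₀)) = ρ ^ 2 by
    field_simp; ring, Real.sqrt_sq hρpos.le]

/-- Integration in bipolar coordinates with foci `0` and `x₀`. -/
lemma lintegral_bipolar_le {x₀ : Space} (hx₀ : x₀ ≠ 0) {F : ℝ × ℝ → ENNReal}
    (hF : Measurable F) :
    ∫⁻ ξ : Space, F (‖ξ‖, ‖x₀ - ξ‖) ≤ ENNReal.ofReal (2 * Real.pi) *
      ∫⁻ r in Set.Ioi (0 : ℝ), ∫⁻ ρ in Set.Ioi (0 : ℝ),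
        ENNReal.ofReal (r * ρ / ‖x₀‖) * F (r, ρ) := by
  have hr₀ : 0 < ‖x₀‖ := norm_pos_iff.mpr hx₀
  set r₀ := ‖x₀‖
  set G : ℝ × ℝ → ENNReal := fun q => F (q.2, √(q.2 ^ 2 + r₀ ^ 2 - 2 * r₀ * q.1)) with hGdef
  have hG : Measurable G := by fun_prop
  have h1 : ∀ ξ : Space, F (‖ξ‖, ‖x₀ - ξ‖) = G (⟪r₀⁻¹ • x₀, ξ⟫, ‖ξ‖) := by
    intro ξ
    simp only [hGdef]
    have h : ‖x₀ - ξ‖ ^ 2 = ‖ξ‖ ^ 2 + r₀ ^ 2 - 2 * r₀ * ⟪r₀⁻¹ • x₀, ξ⟫ := by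
      rw [real_inner_smul_left, norm_sub_sq_real]
      field_simp
      ring
    rw [← h, Real.sqrt_sq (norm_nonneg _)]
  simp_rw [h1]
  rw [lintegral_cylindrical (by rw [norm_smul, norm_inv, norm_norm, inv_mul_cancel₀ hr₀.ne']) hG]
  have h2 : ∀ z : ℝ, ∫⁻ p : ℝ × ℝ, G (z, √(z ^ 2 + (p.1 ^ 2 + p.2 ^ 2))) =
      ENNReal.ofReal (2 * Real.pi) * ∫⁻ r in Set.Ioi |z|, ENNReal.ofReal r * G (z, r) := by
    intro z
    rw [lintegral_radial (g := fun q => G (z, √(z ^ 2 + q))) (by fun_prop),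
      lintegral_mul_comp_sqrt_add_sq z (fun r => G (z, r))]
  simp_rw [h2]
  rw [lintegral_const_mul' _ _ ENNReal.ofReal_ne_top]
  refine mul_le_mul_right ?_ _
  set K : ℝ × ℝ → ENNReal := fun q => ENNReal.ofReal q.2 * G q with hK
  have hKm : Measurable K := by fun_prop
  calc ∫⁻ z, ∫⁻ r in Set.Ioi |z|, K (z, r)
      = ∫⁻ z, ∫⁻ r, {q : ℝ × ℝ | |q.1| < q.2}.indicator K (z, r) := by
        refine lintegral_congr fun z => ?_
        rw [← lintegral_indicator measurableSet_Ioi]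
        rfl
    _ = ∫⁻ r, ∫⁻ z, {q : ℝ × ℝ | |q.1| < q.2}.indicator K (z, r) := by
        refine lintegral_lintegral_swap (Measurable.aemeasurable ?_)
        exact hKm.indicator (measurableSet_lt (by fun_prop) (by fun_prop))
    _ ≤ ∫⁻ r, (Set.Ioi (0 : ℝ)).indicator (fun r =>
          ∫⁻ z in Set.Iio ((r ^ 2 + r₀ ^ 2) / (2 * r₀)), K (z, r)) r := by
        refine lintegral_mono fun r => ?_
        by_cases hr : 0 < r
        · rw [Set.indicator_of_mem (Set.mem_Ioi.mpr hr), ← lintegral_indicator measurableSet_Iio]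
          refine lintegral_mono fun z => ?_
          by_cases hz : |z| < r
          · have hz' : z < (r ^ 2 + r₀ ^ 2) / (2 * r₀) := by
              rw [lt_div_iff₀ (by positivity)]
              nlinarith [sq_nonneg (r - r₀), (abs_lt.mp hz).2]
            rw [Set.indicator_of_mem (Set.mem_Iio.mpr hz'), Set.indicator_of_mem (by exact hz)]
          · rw [Set.indicator_of_notMem (by exact hz)]
            exact zero_le
        · have h0 : ∀ z, {q : ℝ × ℝ | |q.1| < q.2}.indicator K (z, r) = 0 := fun z =>
            Set.indicator_of_notMem (show (z, r) ∉ {q : ℝ × ℝ | |q.1| < q.2} from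
              fun h => hr ((abs_nonneg z).trans_lt h)) _
          simp [h0]
    _ = ∫⁻ r in Set.Ioi (0 : ℝ), ∫⁻ ρ in Set.Ioi (0 : ℝ),
        ENNReal.ofReal (r * ρ / r₀) * F (r, ρ) := by
        rw [lintegral_indicator measurableSet_Ioi]
        refine setLIntegral_congr_fun measurableSet_Ioi fun r hr => ?_
        have hr' : 0 < r := hr
        simp only [hK, hGdef]
        rw [lintegral_const_mul' _ _ ENNReal.ofReal_ne_top,
          lintegral_axial hr₀ (fun ρ => F (r, ρ)), ← lintegral_const_mul' _ _ ENNReal.ofReal_ne_top]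
        refine setLIntegral_congr_fun measurableSet_Ioi fun ρ hρ => ?_
        rw [← mul_assoc, ← ENNReal.ofReal_mul hr'.le, mul_div_assoc]

/-! ## One-dimensional integrals of Japanese brackets -/

/-- The integral of `⟨x⟩^{-β}` over the real line. -/
def japInt (β : ℝ) : ENNReal := ∫⁻ x : ℝ, ENNReal.ofReal (jap x ^ (-β))

lemma japInt_lt_top {β : ℝ} (hβ : 1 < β) : japInt β < ⊤ := by
  have h := (integrable_rpow_neg_one_add_norm_sq (E := ℝ) (μ := volume) (r := β)
    (by simpa using hβ)).lintegral_lt_top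
  refine lt_of_eq_of_lt (lintegral_congr fun x => ?_) h
  rw [jap, Real.sqrt_eq_rpow, ← Real.rpow_mul (by positivity), Real.norm_eq_abs, sq_abs]
  congr 2
  ring

lemma lintegral_jap_affine (c β : ℝ) (e : Bool) :
    ∫⁻ x : ℝ, ENNReal.ofReal (jap (c + sgnv e * x) ^ (-β)) = japInt β := by
  cases e
  · simpa [japInt, sgnv, ← sub_eq_add_neg] using
      lintegral_sub_left_eq_self (μ := volume) (fun x => ENNReal.ofReal (jap x ^ (-β))) c
  · simpa [japInt, sgnv] using
      lintegral_add_left_eq_self (μ := volume) (fun x => ENNReal.ofReal (jap x ^ (-β))) c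

lemma jap_rpow_mul_jap_rpow_le {β : ℝ} (hβ : 0 ≤ β) (x y : ℝ) :
    jap x ^ (-β) * jap y ^ (-β) ≤
      2 ^ β * jap (x + y) ^ (-β) * (jap x ^ (-β) + jap y ^ (-β)) := by
  have hx := jap_pos x
  have hy := jap_pos y
  have hxy := jap_pos (x + y)
  have h (u v : ℝ) (hu : 0 < jap u) (huv : jap (x + y) ≤ 2 * jap u) :
      jap u ^ (-β) ≤ 2 ^ β * jap (x + y) ^ (-β) := by
    have h1 : (jap u) ^ (-β) ≤ (jap (x + y) / 2) ^ (-β) :=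
      Real.rpow_le_rpow_of_nonpos (by positivity) (by linarith) (by linarith)
    refine h1.trans_eq ?_
    rw [Real.div_rpow hxy.le zero_le_two, Real.rpow_neg zero_le_two]
    field_simp
  have hadd := jap_add_le x y
  have px := Real.rpow_nonneg hx.le (-β)
  have py := Real.rpow_nonneg hy.le (-β)
  have pz : 0 ≤ 2 ^ β * jap (x + y) ^ (-β) := by positivity
  rcases le_total (jap x) (jap y) with hle | hle
  · have := mul_le_mul_of_nonneg_left (h y x hy (by linarith)) px
    nlinarith [mul_nonneg pz py]
  · have := mul_le_mul_of_nonneg_right (h x y hx (by linarith)) py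
    nlinarith [mul_nonneg pz px]

lemma lintegral_jap_mul_jap_le {β : ℝ} (hβ : 0 ≤ β) (t u v : ℝ) :
    ∫⁻ τ : ℝ, ENNReal.ofReal (jap (-τ + u) ^ (-β) * jap (-(t - τ) + v) ^ (-β)) ≤
      ENNReal.ofReal (2 ^ β * jap (-t + u + v) ^ (-β)) * (japInt β + japInt β) := by
  have h1 : ∫⁻ τ : ℝ, ENNReal.ofReal (jap (-τ + u) ^ (-β)) = japInt β := by
    rw [← lintegral_jap_affine u β false]
    refine lintegral_congr fun τ => ?_
    congr 3
    simp [sgnv, add_comm]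
  have h2 : ∫⁻ τ : ℝ, ENNReal.ofReal (jap (-(t - τ) + v) ^ (-β)) = japInt β := by
    rw [← lintegral_jap_affine (v - t) β true]
    refine lintegral_congr fun τ => ?_
    congr 3
    simp [sgnv]; ring
  calc _ ≤ ∫⁻ τ : ℝ, ENNReal.ofReal (2 ^ β * jap (-t + u + v) ^ (-β)) *
        (ENNReal.ofReal (jap (-τ + u) ^ (-β)) + ENNReal.ofReal (jap (-(t - τ) + v) ^ (-β))) := by
        refine lintegral_mono fun τ => ?_
        have hx := jap_pos (-τ + u)
        have hy := jap_pos (-(t - τ) + v)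
        have hz := jap_pos (-t + u + v)
        rw [← ENNReal.ofReal_add (by positivity) (by positivity),
          ← ENNReal.ofReal_mul (by positivity)]
        refine ENNReal.ofReal_le_ofReal ((jap_rpow_mul_jap_rpow_le hβ _ _).trans_eq ?_)
        rw [show -τ + u + (-(t - τ) + v) = -t + u + v by ring]
    _ = _ := by
        rw [lintegral_const_mul' _ _ ENNReal.ofReal_ne_top,
          lintegral_add_left (by fun_prop), h1, h2]

lemma lintegral_strip_le {β r₀ : ℝ} (hβ : 0 ≤ β) (c : ℝ) (e : Bool) :
    ∫⁻ r : ℝ, ∫⁻ ρ : ℝ, {q : ℝ × ℝ | |q.2 - q.1| ≤ r₀}.indicator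
      (fun q => ENNReal.ofReal (jap (c + sgnv e * q.1 + sgnv e * q.2) ^ (-β))) (r, ρ) ≤
      japInt β * ENNReal.ofReal (2 * r₀) := by
  have hj (r v : ℝ) : jap (c + sgnv e * r + sgnv e * (r + v)) ^ (-β) ≤
      jap ((c + sgnv e * v) / 2 + sgnv e * r) ^ (-β) := by
    refine Real.rpow_le_rpow_of_nonpos (jap_pos _) (jap_le_jap ?_) (by linarith)
    rw [show c + sgnv e * r + sgnv e * (r + v) = 2 * ((c + sgnv e * v) / 2 + sgnv e * r) by ring,
      abs_mul, abs_two]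
    linarith [abs_nonneg ((c + sgnv e * v) / 2 + sgnv e * r)]
  set H : ℝ × ℝ → ENNReal := fun q => (Set.Icc (-r₀) r₀).indicator
      (fun v => ENNReal.ofReal (jap ((c + sgnv e * v) / 2 + sgnv e * q.1) ^ (-β))) q.2 with hH
  have hHm : Measurable H := by
    have : H = {q : ℝ × ℝ | q.2 ∈ Set.Icc (-r₀) r₀}.indicator (fun q =>
        ENNReal.ofReal (jap ((c + sgnv e * q.2) / 2 + sgnv e * q.1) ^ (-β))) := rfl
    rw [this]
    exact Measurable.indicator (by fun_prop) (measurable_snd measurableSet_Icc)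
  calc _ ≤ ∫⁻ r : ℝ, ∫⁻ v : ℝ, H (r, v) := by
        refine lintegral_mono fun r => ?_
        rw [← lintegral_add_left_eq_self _ r]
        refine lintegral_mono fun v => ?_
        by_cases hv : |v| ≤ r₀
        · rw [Set.indicator_of_mem (by simpa using hv)]
          simp only [hH]
          rw [Set.indicator_of_mem (by exact abs_le.mp hv)]
          exact ENNReal.ofReal_le_ofReal (hj r v)
        · rw [Set.indicator_of_notMem (by simpa using hv)]
          exact zero_le
    _ = ∫⁻ v : ℝ, ∫⁻ r : ℝ, H (r, v) := lintegral_lintegral_swap hHm.aemeasurable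
    _ = ∫⁻ v : ℝ, (Set.Icc (-r₀) r₀).indicator (fun _ => japInt β) v := by
        refine lintegral_congr fun v => ?_
        by_cases hv : v ∈ Set.Icc (-r₀) r₀
        · simp only [hH, Set.indicator_of_mem hv]
          exact lintegral_jap_affine _ _ _
        · simp [hH, Set.indicator_of_notMem hv]
    _ = _ := by
        rw [lintegral_indicator measurableSet_Icc, setLIntegral_const, Real.volume_Icc]
        congr 2
        ring

/-! ## The frequency integral -/

lemma mul_jap_rpow_le {α r : ℝ} (hr : 0 ≤ r) : r * jap r ^ (-α) ≤ jap r ^ (-(α - 1)) := by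
  have h := abs_le_jap r
  rw [abs_of_nonneg hr] at h
  calc r * jap r ^ (-α) ≤ jap r * jap r ^ (-α) := by
        have := jap_pos r
        gcongr
    _ = jap r ^ (-(α - 1)) := by
        rw [show -(α - 1) = 1 + -α by ring, Real.rpow_add (jap_pos r), Real.rpow_one]

lemma sq_mul_jap_rpow_le {α r : ℝ} (hr : 0 ≤ r) (hα : 2 ≤ α) : r ^ 2 * jap r ^ (-α) ≤ 1 := by
  have h := mul_jap_rpow_le (α := α) hr
  have h2 := mul_jap_rpow_le (α := α - 1) hr
  calc r ^ 2 * jap r ^ (-α) = r * (r * jap r ^ (-α)) := by ring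
    _ ≤ r * jap r ^ (-(α - 1)) := by gcongr
    _ ≤ _ := h2
    _ ≤ 1 := Real.rpow_le_one_of_one_le_of_nonpos (one_le_jap r) (by linarith)

/-- The product integral in `(r, ρ)`. -/
lemma lintegral_jap_prod_le (α β c : ℝ) (e₁ e₂ : Bool) :
    ∫⁻ r in Set.Ioi (0 : ℝ), ∫⁻ ρ in Set.Ioi (0 : ℝ), ENNReal.ofReal
      (2 * Real.pi * jap r ^ (-(α - 1)) * jap (c + sgnv e₁ * r + sgnv e₂ * ρ) ^ (-β)) ≤
      ENNReal.ofReal (2 * Real.pi) * (japInt (α - 1) * japInt β) := by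
  have hpi := Real.pi_pos
  calc _ ≤ ∫⁻ r : ℝ, ∫⁻ ρ : ℝ, ENNReal.ofReal
          (2 * Real.pi * jap r ^ (-(α - 1)) * jap (c + sgnv e₁ * r + sgnv e₂ * ρ) ^ (-β)) :=
        (setLIntegral_le_lintegral _ _).trans
          (lintegral_mono fun r => setLIntegral_le_lintegral _ _)
    _ = ∫⁻ r : ℝ, ENNReal.ofReal (2 * Real.pi) * (ENNReal.ofReal (jap r ^ (-(α - 1))) *
          japInt β) := by
        refine lintegral_congr fun r => ?_
        have hr := jap_pos r
        rw [← lintegral_jap_affine (c + sgnv e₁ * r) β e₂, ← mul_assoc,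
          ← ENNReal.ofReal_mul (by positivity), ← lintegral_const_mul' _ _ ENNReal.ofReal_ne_top]
        refine lintegral_congr fun ρ => ?_
        rw [ENNReal.ofReal_mul (by positivity)]
    _ = _ := by
        rw [lintegral_const_mul' _ _ ENNReal.ofReal_ne_top, lintegral_mul_const _ (by fun_prop)]
        rfl

/-- The constant bounding the half of the frequency integral where `|ξ| ≤ |x₀ - ξ|`. -/
def halfConst (α β : ℝ) : ENNReal :=
  ENNReal.ofReal (2 * Real.pi) * (ENNReal.ofReal (2 * Real.pi) * (japInt (α - 1) * japInt β) +
    ENNReal.ofReal (4 * Real.pi) * japInt β)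

/-- The frequency integrand. -/
def freqIntegrand (α β c : ℝ) (e₁ e₂ : Bool) (x₀ ξ : Space) : ENNReal :=
  ENNReal.ofReal (InnerProductGeometry.angle (sgnv e₁ • ξ) (sgnv e₂ • (x₀ - ξ)) *
    jap ‖ξ‖ ^ (-α) * jap (c + sgnv e₁ * ‖ξ‖ + sgnv e₂ * ‖x₀ - ξ‖) ^ (-β))

lemma lintegral_half_le_of_ne {α β c : ℝ} {e₁ e₂ : Bool} (he : e₁ ≠ e₂) {x₀ : Space}
    (hx₀ : x₀ ≠ 0) :
    ∫⁻ ξ : Space, {ξ : Space | ‖ξ‖ ≤ ‖x₀ - ξ‖}.indicator (freqIntegrand α β c e₁ e₂ x₀) ξ ≤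
      halfConst α β := by
  have hpi := Real.pi_pos
  have hr₀ : 0 < ‖x₀‖ := norm_pos_iff.mpr hx₀
  set F : ℝ × ℝ → ENNReal := fun q => ENNReal.ofReal (2 * Real.pi * ‖x₀‖ / q.2 *
    jap q.1 ^ (-α) * jap (c + sgnv e₁ * q.1 + sgnv e₂ * q.2) ^ (-β)) with hF
  have hFm : Measurable F := by fun_prop
  calc _ ≤ ∫⁻ ξ : Space, F (‖ξ‖, ‖x₀ - ξ‖) := by
        refine lintegral_mono (Set.indicator_le fun ξ hξ => ?_)
        have hρ : 0 < ‖x₀ - ξ‖ := by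
          by_contra hn
          have h0 : ‖x₀ - ξ‖ = 0 := le_antisymm (not_lt.mp hn) (norm_nonneg _)
          have h1 : ‖ξ‖ = 0 := le_antisymm (h0 ▸ hξ) (norm_nonneg _)
          rw [norm_eq_zero.mp h1, sub_zero] at h0
          exact hr₀.ne' h0
        have h := angle_mul_norm_le he ξ (x₀ - ξ)
        rw [add_sub_cancel] at h
        have j1 := jap_pos ‖ξ‖
        have j2 := jap_pos (c + sgnv e₁ * ‖ξ‖ + sgnv e₂ * ‖x₀ - ξ‖)
        refine ENNReal.ofReal_le_ofReal ?_
        gcongr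
        exact (le_div_iff₀ hρ).mpr h
    _ ≤ _ := lintegral_bipolar_le hx₀ hFm
    _ ≤ ENNReal.ofReal (2 * Real.pi) * ∫⁻ r in Set.Ioi (0 : ℝ), ∫⁻ ρ in Set.Ioi (0 : ℝ),
        ENNReal.ofReal (2 * Real.pi * jap r ^ (-(α - 1)) *
          jap (c + sgnv e₁ * r + sgnv e₂ * ρ) ^ (-β)) := by
        refine mul_le_mul_right ?_ _
        refine setLIntegral_mono' measurableSet_Ioi fun r hr => ?_
        refine setLIntegral_mono' measurableSet_Ioi fun ρ hρ => ?_
        have hr' : 0 < r := hr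
        have hρ' : 0 < ρ := hρ
        have j1 := jap_pos r
        have j2 := jap_pos (c + sgnv e₁ * r + sgnv e₂ * ρ)
        rw [hF, ← ENNReal.ofReal_mul (by positivity)]
        refine ENNReal.ofReal_le_ofReal ?_
        calc r * ρ / ‖x₀‖ * (2 * Real.pi * ‖x₀‖ / ρ * jap r ^ (-α) *
              jap (c + sgnv e₁ * r + sgnv e₂ * ρ) ^ (-β))
            = 2 * Real.pi * (r * jap r ^ (-α)) *
              jap (c + sgnv e₁ * r + sgnv e₂ * ρ) ^ (-β) := by field_simp
          _ ≤ _ := by gcongr; exact mul_jap_rpow_le hr'.le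
    _ ≤ _ := by
        refine mul_le_mul_right ((lintegral_jap_prod_le α β c e₁ e₂).trans ?_) _
        exact le_self_add

lemma lintegral_half_le_of_eq {α β c : ℝ} (hα : 2 ≤ α) (hβ : 0 ≤ β) (e : Bool) {x₀ : Space}
    (hx₀ : x₀ ≠ 0) :
    ∫⁻ ξ : Space, {ξ : Space | ‖ξ‖ ≤ ‖x₀ - ξ‖}.indicator (freqIntegrand α β c e e x₀) ξ ≤
      halfConst α β := by
  have hpi := Real.pi_pos
  have hr₀ : 0 < ‖x₀‖ := norm_pos_iff.mpr hx₀
  set S : Set (ℝ × ℝ) := {q | q.1 ≤ q.2 ∧ q.2 ≤ q.1 + ‖x₀‖} with hS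
  have hSm : MeasurableSet S :=
    (measurableSet_le measurable_fst measurable_snd).inter
      (measurableSet_le measurable_snd (measurable_fst.add_const _))
  set F : ℝ × ℝ → ENNReal := S.indicator fun q => ENNReal.ofReal (Real.pi *
    jap q.1 ^ (-α) * jap (c + sgnv e * q.1 + sgnv e * q.2) ^ (-β)) with hF
  have hFm : Measurable F := Measurable.indicator (by fun_prop) hSm
  set W : ℝ × ℝ → ENNReal := {q : ℝ × ℝ | |q.2 - q.1| ≤ ‖x₀‖}.indicator
      (fun q => ENNReal.ofReal (jap (c + sgnv e * q.1 + sgnv e * q.2) ^ (-β))) with hW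
  have hWm : Measurable W := Measurable.indicator (by fun_prop)
    (measurableSet_le (by fun_prop) (by fun_prop))
  set P : ℝ × ℝ → ENNReal := fun q => ENNReal.ofReal (2 * Real.pi * jap q.1 ^ (-(α - 1)) *
          jap (c + sgnv e * q.1 + sgnv e * q.2) ^ (-β)) with hP
  have hPm : Measurable P := by fun_prop
  calc _ ≤ ∫⁻ ξ : Space, F (‖ξ‖, ‖x₀ - ξ‖) := by
        refine lintegral_mono (Set.indicator_le fun ξ hξ => ?_)
        have hmem : (‖ξ‖, ‖x₀ - ξ‖) ∈ S :=
          ⟨hξ, (norm_sub_le x₀ ξ).trans_eq (add_comm _ _)⟩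
        have j1 := jap_pos ‖ξ‖
        have j2 := jap_pos (c + sgnv e * ‖ξ‖ + sgnv e * ‖x₀ - ξ‖)
        rw [hF, Set.indicator_of_mem hmem]
        refine ENNReal.ofReal_le_ofReal ?_
        gcongr
        exact InnerProductGeometry.angle_le_pi _ _
    _ ≤ _ := lintegral_bipolar_le hx₀ hFm
    _ ≤ ENNReal.ofReal (2 * Real.pi) * ∫⁻ r in Set.Ioi (0 : ℝ), ∫⁻ ρ in Set.Ioi (0 : ℝ),
        (P (r, ρ) + ENNReal.ofReal (2 * Real.pi / ‖x₀‖) * W (r, ρ)) := by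
        refine mul_le_mul_right ?_ _
        refine setLIntegral_mono' measurableSet_Ioi fun r hr => ?_
        refine setLIntegral_mono' measurableSet_Ioi fun ρ hρ => ?_
        have hr' : 0 < r := hr
        have hρ' : 0 < ρ := hρ
        have j1 := jap_pos r
        have j2 := jap_pos (c + sgnv e * r + sgnv e * ρ)
        by_cases hq : (r, ρ) ∈ S
        swap
        · rw [hF, Set.indicator_of_notMem hq, mul_zero]
          exact zero_le
        have hq1 : r ≤ ρ := hq.1
        have hq2 : ρ ≤ r + ‖x₀‖ := hq.2
        rw [hF, Set.indicator_of_mem hq, ← ENNReal.ofReal_mul (by positivity)]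
        rcases le_total r ‖x₀‖ with hle | hle
        · refine le_trans (ENNReal.ofReal_le_ofReal ?_) le_self_add
          have h1 : r * ρ / ‖x₀‖ ≤ 2 * r := by
            rw [div_le_iff₀ hr₀]; nlinarith
          calc r * ρ / ‖x₀‖ * (Real.pi * jap r ^ (-α) *
                jap (c + sgnv e * r + sgnv e * ρ) ^ (-β))
              ≤ 2 * r * (Real.pi * jap r ^ (-α) *
                jap (c + sgnv e * r + sgnv e * ρ) ^ (-β)) := by gcongr
            _ = 2 * Real.pi * (r * jap r ^ (-α)) *
                jap (c + sgnv e * r + sgnv e * ρ) ^ (-β) := by ring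
            _ ≤ _ := by gcongr; exact mul_jap_rpow_le hr'.le
        · have hmem : (r, ρ) ∈ {q : ℝ × ℝ | |q.2 - q.1| ≤ ‖x₀‖} := by
            show |ρ - r| ≤ ‖x₀‖
            exact abs_le.mpr ⟨by linarith, by linarith⟩
          refine le_trans ?_ le_add_self
          rw [hW, Set.indicator_of_mem hmem, ← ENNReal.ofReal_mul (by positivity)]
          refine ENNReal.ofReal_le_ofReal ?_
          have h1 : r * ρ ≤ 2 * r ^ 2 := by nlinarith
          calc r * ρ / ‖x₀‖ * (Real.pi * jap r ^ (-α) *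
                jap (c + sgnv e * r + sgnv e * ρ) ^ (-β))
              ≤ 2 * r ^ 2 / ‖x₀‖ * (Real.pi * jap r ^ (-α) *
                jap (c + sgnv e * r + sgnv e * ρ) ^ (-β)) := by gcongr
            _ = 2 * Real.pi / ‖x₀‖ * jap (c + sgnv e * r + sgnv e * ρ) ^ (-β) *
                (r ^ 2 * jap r ^ (-α)) := by ring
            _ ≤ 2 * Real.pi / ‖x₀‖ * jap (c + sgnv e * r + sgnv e * ρ) ^ (-β) * 1 := by
                gcongr; exact sq_mul_jap_rpow_le hr'.le hα
            _ = _ := mul_one _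
    _ = ENNReal.ofReal (2 * Real.pi) * ((∫⁻ r in Set.Ioi (0 : ℝ), ∫⁻ ρ in Set.Ioi (0 : ℝ),
        P (r, ρ)) + ENNReal.ofReal (2 * Real.pi / ‖x₀‖) *
          ∫⁻ r in Set.Ioi (0 : ℝ), ∫⁻ ρ in Set.Ioi (0 : ℝ), W (r, ρ)) := by
        congr 1
        rw [← lintegral_const_mul' _ _ ENNReal.ofReal_ne_top, ← lintegral_add_left]
        · refine lintegral_congr fun r => ?_
          rw [← lintegral_const_mul' _ _ ENNReal.ofReal_ne_top,
            ← lintegral_add_left (by fun_prop)]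
        · exact hPm.lintegral_prod_right'
    _ ≤ _ := by
        refine mul_le_mul_right (add_le_add (lintegral_jap_prod_le α β c e e) ?_) _
        calc _ ≤ ENNReal.ofReal (2 * Real.pi / ‖x₀‖) * (japInt β * ENNReal.ofReal (2 * ‖x₀‖)) := by
              refine mul_le_mul_right (le_trans ?_ (lintegral_strip_le hβ c e)) _
              exact (setLIntegral_le_lintegral _ _).trans
                (lintegral_mono fun r => setLIntegral_le_lintegral _ _)
          _ = ENNReal.ofReal (2 * Real.pi / ‖x₀‖) * ENNReal.ofReal (2 * ‖x₀‖) * japInt β := by ring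
          _ = _ := by
              rw [← ENNReal.ofReal_mul (by positivity)]
              congr 2
              field_simp
              ring

lemma lintegral_half_le {α β c : ℝ} (hα : 2 ≤ α) (hβ : 0 ≤ β) (e₁ e₂ : Bool) {x₀ : Space}
    (hx₀ : x₀ ≠ 0) :
    ∫⁻ ξ : Space, {ξ : Space | ‖ξ‖ ≤ ‖x₀ - ξ‖}.indicator (freqIntegrand α β c e₁ e₂ x₀) ξ ≤
      halfConst α β := by
  by_cases he : e₁ = e₂
  · subst he; exact lintegral_half_le_of_eq hα hβ e₁ hx₀
  · exact lintegral_half_le_of_ne he hx₀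

lemma halfConst_lt_top {α β : ℝ} (hα : 2 < α) (hβ : 1 < β) : halfConst α β < ⊤ := by
  have h1 := japInt_lt_top hβ
  have h2 := japInt_lt_top (β := α - 1) (by linarith)
  exact ENNReal.mul_lt_top ENNReal.ofReal_lt_top (ENNReal.add_lt_top.mpr
    ⟨ENNReal.mul_lt_top ENNReal.ofReal_lt_top (ENNReal.mul_lt_top h2 h1),
      ENNReal.mul_lt_top ENNReal.ofReal_lt_top h1⟩)

lemma lintegral_angle_jap_le {α β c : ℝ} (hα : 2 ≤ α) (hβ : 0 ≤ β) (e₁ e₂ : Bool) {x₀ : Space}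
    (hx₀ : x₀ ≠ 0) :
    ∫⁻ ξ : Space, ENNReal.ofReal
      (InnerProductGeometry.angle (sgnv e₁ • ξ) (sgnv e₂ • (x₀ - ξ)) *
        jap (min ‖ξ‖ ‖x₀ - ξ‖) ^ (-α) *
        jap (c + sgnv e₁ * ‖ξ‖ + sgnv e₂ * ‖x₀ - ξ‖) ^ (-β)) ≤
      halfConst α β + halfConst α β := by
  set f : Space → ENNReal :=
    {ξ : Space | ‖ξ‖ ≤ ‖x₀ - ξ‖}.indicator (freqIntegrand α β c e₁ e₂ x₀) with hf
  set g : Space → ENNReal :=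
    {ξ : Space | ‖ξ‖ ≤ ‖x₀ - ξ‖}.indicator (freqIntegrand α β c e₂ e₁ x₀) with hg
  have hfm : Measurable f := by
    refine Measurable.indicator ?_ (measurableSet_le (by fun_prop) (by fun_prop))
    unfold freqIntegrand InnerProductGeometry.angle
    have := Real.measurable_arccos
    fun_prop
  calc _ ≤ ∫⁻ ξ : Space, (f ξ + g (x₀ - ξ)) := by
        refine lintegral_mono fun ξ => ?_
        rcases le_total ‖ξ‖ ‖x₀ - ξ‖ with h | h
        · refine le_trans ?_ le_self_add
          rw [min_eq_left h, hf, Set.indicator_of_mem (by exact h)]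
          rfl
        · refine le_trans ?_ le_add_self
          rw [min_eq_right h, hg, Set.indicator_of_mem (by simpa using h)]
          rw [freqIntegrand, sub_sub_cancel, InnerProductGeometry.angle_comm]
          rw [add_right_comm]
    _ = (∫⁻ ξ : Space, f ξ) + ∫⁻ ξ : Space, g ξ := by
        rw [lintegral_add_left hfm, lintegral_sub_left_eq_self]
    _ ≤ _ := add_le_add (lintegral_half_le hα hβ e₁ e₂ hx₀) (lintegral_half_le hα hβ e₂ e₁ hx₀)

/-! ## The kernel of the null form -/

lemma rpow_mul_rpow_min_le {s l P Q Z : ℝ} (hl : 0 ≤ l) (hs : l ≤ s) (hP : 0 < P) (hQ : 0 < Q)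
    (hZ : 0 ≤ Z) (hZPQ : Z ≤ P + Q) : Z ^ l * min P Q ^ s ≤ 2 ^ l * (P ^ s * Q ^ l) := by
  rcases le_total P Q with h | h
  · rw [min_eq_left h]
    calc Z ^ l * P ^ s ≤ (2 * Q) ^ l * P ^ s := by
          gcongr
          linarith
      _ = 2 ^ l * (P ^ s * Q ^ l) := by
          rw [Real.mul_rpow (by norm_num) hQ.le]; ring
  · rw [min_eq_right h]
    have h1 : P ^ l * Q ^ s ≤ P ^ s * Q ^ l := by
      have hP' : P ^ s = P ^ l * P ^ (s - l) := by rw [← Real.rpow_add hP]; congr 1; ring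
      have hQ' : Q ^ s = Q ^ l * Q ^ (s - l) := by rw [← Real.rpow_add hQ]; congr 1; ring
      have h2 : Q ^ (s - l) ≤ P ^ (s - l) := Real.rpow_le_rpow hQ.le h (by linarith)
      calc P ^ l * Q ^ s = P ^ l * Q ^ l * Q ^ (s - l) := by rw [hQ']; ring
        _ ≤ P ^ l * Q ^ l * P ^ (s - l) := by gcongr
        _ = P ^ s * Q ^ l := by rw [hP']; ring
    calc Z ^ l * Q ^ s ≤ (2 * P) ^ l * Q ^ s := by
          gcongr
          linarith
      _ = 2 ^ l * (P ^ l * Q ^ s) := by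
          rw [Real.mul_rpow (by norm_num) hP.le]; ring
      _ ≤ _ := by gcongr

lemma le_rpow_of_sq_mul_le {κ T M S K : ℝ} (hκ : 0 < κ) (hκ' : κ ≤ 1 / 4) (hT : 0 ≤ T)
    (hTpi : T ≤ Real.pi) (hM : 0 < M) (hS : 0 ≤ S) (hK : 0 ≤ K) (h : T ^ 2 * M ≤ K * S) :
    T ≤ K ^ κ * Real.pi ^ (1 / 2 - 2 * κ) * (√T * M ^ (-κ) * S ^ κ) := by
  rcases hT.eq_or_lt with rfl | hT0
  · positivity
  have h1 : T ^ (2 * κ) ≤ K ^ κ * S ^ κ * M ^ (-κ) := by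
    rw [Real.rpow_neg hM.le, ← div_eq_mul_inv, le_div_iff₀ (by positivity),
      ← Real.mul_rpow hK hS, Real.rpow_mul hT, ← Real.mul_rpow (by positivity) hM.le]
    refine Real.rpow_le_rpow (by positivity) ?_ hκ.le
    simpa using h
  have h2 : T ^ (1 / 2 - 2 * κ) ≤ Real.pi ^ (1 / 2 - 2 * κ) :=
    Real.rpow_le_rpow hT hTpi (by linarith)
  calc T = T ^ (2 * κ) * T ^ (1 / 2 - 2 * κ) * √T := by
        rw [Real.sqrt_eq_rpow, ← Real.rpow_add hT0, ← Real.rpow_add hT0]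
        ring_nf
        rw [Real.rpow_one]
    _ ≤ (K ^ κ * S ^ κ * M ^ (-κ)) * Real.pi ^ (1 / 2 - 2 * κ) * √T := by
        have := Real.pi_pos
        gcongr
    _ = _ := by ring

/-- The square root of the kernel that remains after the weights are distributed. -/
def nullKernel (a b : ℝ) (e₁ e₂ : Bool) (ζ η : SpaceTime) : ℝ :=
  √(InnerProductGeometry.angle (sgnv e₁ • spt η) (sgnv e₂ • (spt ζ - spt η))) *
    jap (min ‖spt η‖ ‖spt ζ - spt η‖) ^ (-a) *
    (jap (-(η 0) + sgnv e₁ * ‖spt η‖) ^ (-b) *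
      jap (-(ζ 0 - η 0) + sgnv e₂ * ‖spt ζ - spt η‖) ^ (-b))

lemma nullKernel_nonneg (a b : ℝ) (e₁ e₂ : Bool) (ζ η : SpaceTime) :
    0 ≤ nullKernel a b e₁ e₂ ζ η := by
  have h := jap_pos
  unfold nullKernel
  have h1 := (h (min ‖spt η‖ ‖spt ζ - spt η‖)).le
  have h2 := (h (-(η 0) + sgnv e₁ * ‖spt η‖)).le
  have h3 := (h (-(ζ 0 - η 0) + sgnv e₂ * ‖spt ζ - spt η‖)).le
  positivity

lemma spt_sub (ζ η : SpaceTime) : spt (ζ - η) = spt ζ - spt η := rfl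

lemma xWt_pos (sg : Bool) (s b : ℝ) (ζ : SpaceTime) : 0 < xWt sg s b ζ :=
  mul_pos (Real.rpow_pos_of_pos (jap_pos _) _) (Real.rpow_pos_of_pos (jap_pos _) _)

/-- The constant in the pointwise bound of the symbol. -/
def symbConst (κ l : ℝ) : ℝ := 2 ^ l * ((6 * Real.pi ^ 2) ^ κ * Real.pi ^ (1 / 2 - 2 * κ))

lemma symbConst_pos (κ l : ℝ) : 0 < symbConst κ l := by
  have := Real.pi_pos
  unfold symbConst
  positivity

lemma xWt_mul_angleWt_le {s l κ : ℝ} (b : ℝ) (hl : 0 ≤ l) (hs : l ≤ s) (hκ : 0 < κ)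
    (hκ' : κ ≤ 1 / 4) (e₀ e₁ e₂ : Bool) (ζ η : SpaceTime) :
    xWt e₀ l (-κ) ζ * angleWt e₁ e₂ η (ζ - η) ≤
      symbConst κ l * (nullKernel (s + κ) b e₁ e₂ ζ η *
        (xWt e₁ s (κ + b) η * xWt e₂ l (κ + b) (ζ - η))) := by
  have hang := angle_sq_mul_jap_le e₀ e₁ e₂ (ζ 0) (η 0) (spt η) (spt ζ - spt η)
  have hmin := jap_min (norm_nonneg (spt η)) (norm_nonneg (spt ζ - spt η))
  rw [add_sub_cancel] at hang
  have hZ : jap ‖spt ζ‖ ≤ jap ‖spt η‖ + jap ‖spt ζ - spt η‖ := by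
    refine (jap_le_jap ?_).trans (jap_add_le ‖spt η‖ ‖spt ζ - spt η‖)
    rw [abs_norm, abs_of_nonneg (by positivity)]
    simpa using norm_add_le (spt η) (spt ζ - spt η)
  have hPQ := rpow_mul_rpow_min_le hl hs (jap_pos ‖spt η‖) (jap_pos ‖spt ζ - spt η‖)
    (jap_pos ‖spt ζ‖).le hZ
  simp only [xWt, angleWt, nullKernel, symbConst, spt_sub]
  rw [abs_of_nonneg (InnerProductGeometry.angle_nonneg _ _), PiLp.sub_apply]
  rw [← hmin] at hPQ
  have hT := InnerProductGeometry.angle_nonneg (sgnv e₁ • spt η) (sgnv e₂ • (spt ζ - spt η))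
  have hTpi := InnerProductGeometry.angle_le_pi (sgnv e₁ • spt η) (sgnv e₂ • (spt ζ - spt η))
  have hM := jap_pos (min ‖spt η‖ ‖spt ζ - spt η‖)
  have h0 := jap_pos (-(ζ 0) + sgnv e₀ * ‖spt ζ‖)
  have h1 := jap_pos (-(η 0) + sgnv e₁ * ‖spt η‖)
  have h2 := jap_pos (-(ζ 0 - η 0) + sgnv e₂ * ‖spt ζ - spt η‖)
  have hP := jap_pos ‖spt η‖
  have hQ := jap_pos ‖spt ζ - spt η‖
  have hR := jap_pos ‖spt ζ‖
  generalize InnerProductGeometry.angle (sgnv e₁ • spt η) (sgnv e₂ • (spt ζ - spt η)) = T at *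
  generalize jap (min ‖spt η‖ ‖spt ζ - spt η‖) = M at *
  generalize jap (-(ζ 0) + sgnv e₀ * ‖spt ζ‖) = S₀ at *
  generalize jap (-(η 0) + sgnv e₁ * ‖spt η‖) = S₁ at *
  generalize jap (-(ζ 0 - η 0) + sgnv e₂ * ‖spt ζ - spt η‖) = S₂ at *
  generalize jap ‖spt η‖ = P at *
  generalize jap ‖spt ζ - spt η‖ = Q at *
  generalize jap ‖spt ζ‖ = Z at *
  have hT' := le_rpow_of_sq_mul_le hκ hκ' hT hTpi hM (by positivity) (by positivity) hang
  set c := (6 * Real.pi ^ 2) ^ κ * Real.pi ^ (1 / 2 - 2 * κ) with hc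
  have hc0 : 0 ≤ c := by have := Real.pi_pos; positivity
  have e0 : S₀ ^ (-κ) * S₀ ^ κ = 1 := by rw [← Real.rpow_add h0]; simp
  have e1 : S₁ ^ (-b) * S₁ ^ (κ + b) = S₁ ^ κ := by rw [← Real.rpow_add h1]; congr 1; ring
  have e2 : S₂ ^ (-b) * S₂ ^ (κ + b) = S₂ ^ κ := by rw [← Real.rpow_add h2]; congr 1; ring
  have eM : M ^ (-κ) = M ^ s * M ^ (-(s + κ)) := by rw [← Real.rpow_add hM]; congr 1; ring
  calc Z ^ l * S₀ ^ (-κ) * T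
      ≤ Z ^ l * S₀ ^ (-κ) * (c * (√T * M ^ (-κ) * (S₀ * S₁ * S₂) ^ κ)) := by gcongr
    _ = (Z ^ l * M ^ s) * (c * (√T * M ^ (-(s + κ)) * (S₁ ^ κ * S₂ ^ κ))) *
          (S₀ ^ (-κ) * S₀ ^ κ) := by
        rw [Real.mul_rpow (by positivity) h2.le, Real.mul_rpow h0.le h1.le, eM]; ring
    _ ≤ (2 ^ l * (P ^ s * Q ^ l)) * (c * (√T * M ^ (-(s + κ)) * (S₁ ^ κ * S₂ ^ κ))) *
          (S₀ ^ (-κ) * S₀ ^ κ) := by gcongr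
    _ = _ := by rw [e0, ← e1, ← e2]; ring

lemma nullKernel_sq (a b : ℝ) (e₁ e₂ : Bool) (ζ η : SpaceTime) :
    nullKernel a b e₁ e₂ ζ η ^ 2 =
      InnerProductGeometry.angle (sgnv e₁ • spt η) (sgnv e₂ • (spt ζ - spt η)) *
        jap (min ‖spt η‖ ‖spt ζ - spt η‖) ^ (-(2 * a)) *
        (jap (-(η 0) + sgnv e₁ * ‖spt η‖) ^ (-(2 * b)) *
          jap (-(ζ 0 - η 0) + sgnv e₂ * ‖spt ζ - spt η‖) ^ (-(2 * b))) := by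
  have h (x c : ℝ) : (jap x ^ (-c)) ^ 2 = jap x ^ (-(2 * c)) := by
    rw [← Real.rpow_natCast, ← Real.rpow_mul (jap_pos x).le]
    congr 1
    push_cast
    ring
  simp only [nullKernel, mul_pow, h, Real.sq_sqrt (InnerProductGeometry.angle_nonneg _ _)]

/-- The constant in the bound of the kernel in `L²`. -/
def kernelConst (a b : ℝ) : ENNReal :=
  ENNReal.ofReal (2 ^ (2 * b)) * (japInt (2 * b) + japInt (2 * b)) *
    (halfConst (2 * a) (2 * b) + halfConst (2 * a) (2 * b))

lemma kernelConst_lt_top {a b : ℝ} (ha : 1 < a) (hb : 1 / 2 < b) : kernelConst a b < ⊤ := by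
  have h1 := japInt_lt_top (β := 2 * b) (by linarith)
  have h2 := halfConst_lt_top (α := 2 * a) (β := 2 * b) (by linarith) (by linarith)
  exact ENNReal.mul_lt_top (ENNReal.mul_lt_top ENNReal.ofReal_lt_top
    (ENNReal.add_lt_top.mpr ⟨h1, h1⟩)) (ENNReal.add_lt_top.mpr ⟨h2, h2⟩)

lemma lintegral_nullKernel_sq_le {a b : ℝ} (ha : 1 ≤ a) (hb : 0 ≤ b) (e₁ e₂ : Bool)
    {ζ : SpaceTime} (hζ : spt ζ ≠ 0) :
    ∫⁻ η : SpaceTime, ENNReal.ofReal (nullKernel a b e₁ e₂ ζ η ^ 2) ≤ kernelConst a b := by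
  set W : Space → ℝ := fun ξ =>
    InnerProductGeometry.angle (sgnv e₁ • ξ) (sgnv e₂ • (spt ζ - ξ)) *
      jap (min ‖ξ‖ ‖spt ζ - ξ‖) ^ (-(2 * a)) with hW
  have hW0 (ξ : Space) : 0 ≤ W ξ :=
    mul_nonneg (InnerProductGeometry.angle_nonneg _ _) (Real.rpow_nonneg (jap_pos _).le _)
  set G : ℝ × Space → ENNReal := fun q => ENNReal.ofReal (W q.2 *
    (jap (-q.1 + sgnv e₁ * ‖q.2‖) ^ (-(2 * b)) *
      jap (-(ζ 0 - q.1) + sgnv e₂ * ‖spt ζ - q.2‖) ^ (-(2 * b)))) with hG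
  have hWm : Measurable W := by
    have := Real.measurable_arccos
    unfold W InnerProductGeometry.angle
    fun_prop
  have hGm : Measurable G := by fun_prop
  calc _ = ∫⁻ η : SpaceTime, G (η 0, spt η) := by simp only [nullKernel_sq, hG, hW]
    _ = ∫⁻ ξ : Space, ∫⁻ τ : ℝ, G (τ, ξ) := lintegral_spaceTime hGm
    _ ≤ ∫⁻ ξ : Space, ENNReal.ofReal (2 ^ (2 * b)) * (japInt (2 * b) + japInt (2 * b)) *
          ENNReal.ofReal (W ξ * jap (-(ζ 0) + sgnv e₁ * ‖ξ‖ + sgnv e₂ * ‖spt ζ - ξ‖) ^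
            (-(2 * b))) := by
        refine lintegral_mono fun ξ => ?_
        simp only [hG, ENNReal.ofReal_mul (hW0 ξ)]
        rw [lintegral_const_mul _ (by fun_prop)]
        refine (mul_le_mul_right (lintegral_jap_mul_jap_le (by linarith) _ _ _) _).trans_eq ?_
        rw [ENNReal.ofReal_mul (p := 2 ^ (2 * b)) (by positivity)]
        ring
    _ ≤ _ := by
        rw [lintegral_const_mul _ (by fun_prop)]
        exact mul_le_mul_right (lintegral_angle_jap_le (by linarith) (by linarith) e₁ e₂ hζ) _

lemma ae_spt_ne (x : Space) : ∀ᵐ ζ : SpaceTime, spt ζ ≠ x := by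
  have h : ∀ᵐ q : ℝ × Space, q.2 ≠ x :=
    Measure.quasiMeasurePreserving_snd.ae (Measure.ae_ne volume x)
  exact measurePreserving_time_spt.quasiMeasurePreserving.ae h

/-! ## From the kernel bound to the null form estimate -/

lemma fourier_eq_zero_of_not_integrable {F : SpaceTime → ℂ} (hF : ¬ Integrable F)
    (ζ : SpaceTime) : 𝓕 F ζ = 0 := by
  rw [Real.fourier_eq]
  refine integral_undef fun h => hF ?_
  exact (Real.fourierIntegral_convergent_iff ζ).mp h

lemma norm_FT_FTinv_le {F : SpaceTime → ℂ} {ζ : SpaceTime} (hζ : ContinuousAt F ζ) :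
    ‖FT (FTinv F) ζ‖ ≤ ‖F ζ‖ := by
  change ‖𝓕 (𝓕⁻ F) ζ‖ ≤ ‖F ζ‖
  by_cases hF : Integrable F
  · by_cases hF' : Integrable (𝓕⁻ F)
    · have h : Integrable (𝓕 F) := by
        simpa [Real.fourierInv_eq_fourier_neg] using hF'.comp_neg
      rw [hF.fourier_fourierInv_eq h hζ]
    · rw [fourier_eq_zero_of_not_integrable hF']
      simp
  · have h : 𝓕⁻ F = 0 := by
      funext x
      rw [Real.fourierInv_eq_fourier_neg, fourier_eq_zero_of_not_integrable hF]
      rfl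
    rw [h, Real.fourier_eq]
    simp

lemma lintegral_mul_sq_le {f g : SpaceTime → ENNReal} (hf : Measurable f) (hg : Measurable g) :
    (∫⁻ η, f η * g η) ^ 2 ≤ (∫⁻ η, f η ^ 2) * ∫⁻ η, g η ^ 2 := by
  have h := ENNReal.lintegral_mul_le_Lp_mul_Lq (volume : Measure SpaceTime)
    Real.HolderConjugate.two_two hf.aemeasurable hg.aemeasurable
  have hsq (x : ENNReal) : (x ^ (1 / 2 : ℝ)) ^ 2 = x := by
    rw [← ENNReal.rpow_two, ← ENNReal.rpow_mul]; norm_num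
  simp only [Pi.mul_apply, ENNReal.rpow_two] at h
  calc _ ≤ _ := pow_le_pow_left' h 2
    _ = _ := by rw [mul_pow, hsq, hsq]

lemma lintegral_kernel_sq_le {k : SpaceTime → SpaceTime → ENNReal} {K : ENNReal}
    {f g : SpaceTime → ENNReal} (hk : ∀ ζ, Measurable (k ζ))
    (hK : ∀ᵐ ζ, ∫⁻ η, k ζ η ^ 2 ≤ K) (hf : Measurable f) (hg : Measurable g) :
    ∫⁻ ζ, (∫⁻ η, k ζ η * (f η * g (ζ - η))) ^ 2 ≤
      K * ((∫⁻ η, f η ^ 2) * ∫⁻ η, g η ^ 2) := by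
  calc _ ≤ ∫⁻ ζ, K * ∫⁻ η, f η ^ 2 * g (ζ - η) ^ 2 := by
        refine lintegral_mono_ae ?_
        filter_upwards [hK] with ζ hζ
        refine (lintegral_mul_sq_le (hk ζ) (by fun_prop)).trans ?_
        simp only [mul_pow]
        gcongr
    _ = K * ∫⁻ ζ, ∫⁻ η, f η ^ 2 * g (ζ - η) ^ 2 := by
        refine lintegral_const_mul _ ?_
        exact Measurable.lintegral_prod_right' (f := fun q : SpaceTime × SpaceTime =>
          f q.2 ^ 2 * g (q.1 - q.2) ^ 2) (by fun_prop)
    _ = K * ∫⁻ η, f η ^ 2 * ∫⁻ ζ, g ζ ^ 2 := by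
        rw [lintegral_lintegral_swap (by unfold Function.uncurry; fun_prop)]
        congr 1
        refine lintegral_congr fun η => ?_
        rw [lintegral_const_mul _ (by fun_prop),
          lintegral_sub_right_eq_self (fun ζ => g ζ ^ 2) η]
    _ = _ := by rw [lintegral_mul_const _ (by fun_prop)]

lemma continuous_spt : Continuous spt :=
  (PiLp.continuous_toLp 2 fun _ : Fin 3 => ℝ).comp
    (f := fun (z : SpaceTime) (i : Fin 3) => z i.succ) (by fun_prop)

lemma continuous_xWt (sg : Bool) (s b : ℝ) : Continuous (xWt sg s b) := by
  have h := continuous_spt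
  have hj := continuous_jap
  unfold xWt
  refine Continuous.mul (Continuous.rpow_const (by fun_prop) fun _ => Or.inl (jap_pos _).ne')
    (Continuous.rpow_const (by fun_prop) fun _ => Or.inl (jap_pos _).ne')

lemma norm_spt_le (ζ : SpaceTime) : ‖spt ζ‖ ≤ ‖ζ‖ := by
  rw [EuclideanSpace.norm_eq, EuclideanSpace.norm_eq]
  refine Real.sqrt_le_sqrt ?_
  rw [Fin.sum_univ_succ (n := 3)]
  exact le_add_of_nonneg_left (by positivity)

lemma xWt_le (sg : Bool) {s b : ℝ} (hs : 0 ≤ s) (hb : 0 ≤ b) (ζ : SpaceTime) :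
    xWt sg s b ζ ≤ 2 ^ b * (1 + ‖ζ‖) ^ ⌈s + b⌉₊ := by
  have h1 : jap ‖spt ζ‖ ≤ 1 + ‖ζ‖ := by
    refine (jap_le_one_add_abs _).trans ?_
    rw [abs_norm]
    gcongr
    exact norm_spt_le ζ
  have h2 : jap (-(ζ 0) + sgnv sg * ‖spt ζ‖) ≤ 2 * (1 + ‖ζ‖) := by
    refine (jap_le_one_add_abs _).trans ?_
    have h3 : |-(ζ 0) + sgnv sg * ‖spt ζ‖| ≤ |ζ 0| + ‖spt ζ‖ := by
      refine (abs_add_le _ _).trans ?_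
      rw [abs_neg, abs_mul, abs_sgnv, abs_norm, one_mul]
    have h4 : |ζ 0| ≤ ‖ζ‖ := PiLp.norm_apply_le ζ 0
    linarith [norm_spt_le ζ]
  have h0 := jap_pos ‖spt ζ‖
  have h0' := jap_pos (-(ζ 0) + sgnv sg * ‖spt ζ‖)
  calc xWt sg s b ζ ≤ (1 + ‖ζ‖) ^ s * (2 * (1 + ‖ζ‖)) ^ b := by unfold xWt; gcongr
    _ = 2 ^ b * (1 + ‖ζ‖) ^ (s + b) := by
        rw [Real.mul_rpow (by norm_num) (by positivity), Real.rpow_add (by positivity)]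
        ring
    _ ≤ _ := by
        rw [← Real.rpow_natCast]
        gcongr
        · linarith [norm_nonneg ζ]
        · exact Nat.le_ceil _

lemma exists_one_add_norm_pow_mul_le (f : SchwartzMap SpaceTime ℂ) (k : ℕ) :
    ∃ C, ∀ x, (1 + ‖x‖) ^ k * ‖f x‖ ≤ C := by
  have h := f.one_add_le_sup_seminorm_apply (𝕜 := ℝ) (m := (k, 0)) le_rfl le_rfl
  simp only [norm_iteratedFDeriv_zero] at h
  exact ⟨_, h⟩

lemma integrable_xWt_mul_sq (sg : Bool) {s b : ℝ} (hs : 0 ≤ s) (hb : 0 ≤ b)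
    (f : SchwartzMap SpaceTime ℂ) : Integrable fun ζ => (xWt sg s b ζ * ‖f ζ‖) ^ 2 := by
  obtain ⟨C, hC⟩ := exists_one_add_norm_pow_mul_le f (⌈s + b⌉₊ + 3)
  have hint : Integrable (fun ζ : SpaceTime => (2 ^ b * C) ^ 2 * (1 + ‖ζ‖) ^ (-6 : ℝ)) :=
    (integrable_one_add_norm (by simp; norm_num)).const_mul _
  have hcont : Continuous fun ζ => (xWt sg s b ζ * ‖f ζ‖) ^ 2 :=
    ((continuous_xWt sg s b).mul f.continuous.norm).pow 2
  refine hint.mono' hcont.aestronglyMeasurable (Filter.Eventually.of_forall fun ζ => ?_)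
  have hw := (xWt_pos sg s b ζ).le
  have hn : 0 < 1 + ‖ζ‖ := by positivity
  have h : xWt sg s b ζ * ‖f ζ‖ ≤ 2 ^ b * C * ((1 + ‖ζ‖) ^ 3)⁻¹ := by
    rw [← div_eq_mul_inv, le_div_iff₀ (by positivity)]
    calc _ ≤ 2 ^ b * (1 + ‖ζ‖) ^ ⌈s + b⌉₊ * ‖f ζ‖ * (1 + ‖ζ‖) ^ 3 := by
          gcongr; exact xWt_le sg hs hb ζ
      _ = 2 ^ b * ((1 + ‖ζ‖) ^ (⌈s + b⌉₊ + 3) * ‖f ζ‖) := by ring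
      _ ≤ _ := by gcongr; exact hC ζ
  rw [Real.norm_of_nonneg (by positivity)]
  calc _ ≤ (2 ^ b * C * ((1 + ‖ζ‖) ^ 3)⁻¹) ^ 2 := by gcongr
    _ = _ := by
      rw [Real.rpow_neg hn.le, mul_pow, ← inv_pow, ← pow_mul, inv_pow]
      norm_cast

lemma abs_angleWt_le (e₁ e₂ : Bool) (η θ : SpaceTime) : |angleWt e₁ e₂ η θ| ≤ Real.pi := by
  rw [angleWt, abs_abs, abs_of_nonneg (InnerProductGeometry.angle_nonneg _ _)]
  exact InnerProductGeometry.angle_le_pi _ _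

lemma measurable_angleWt_sub (e₁ e₂ : Bool) (ζ : SpaceTime) :
    Measurable fun η => angleWt e₁ e₂ η (ζ - η) := by
  have := Real.measurable_arccos
  have := measurable_spt
  unfold angleWt InnerProductGeometry.angle
  fun_prop

lemma continuousAt_angleWt_sub (e₁ e₂ : Bool) {ζ η : SpaceTime} (h1 : spt η ≠ 0)
    (h2 : spt η ≠ spt ζ) : ContinuousAt (fun ζ => angleWt e₁ e₂ η (ζ - η)) ζ := by
  have hs := continuous_spt
  have h := InnerProductGeometry.continuousAt_angle
    (x := (sgnv e₁ • spt η, sgnv e₂ • spt (ζ - η)))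
    (smul_ne_zero (sgnv_ne_zero _) h1)
    (smul_ne_zero (sgnv_ne_zero _) (by rw [spt_sub]; exact sub_ne_zero.mpr h2.symm))
  exact (ContinuousAt.comp (f := fun ζ => (sgnv e₁ • spt η, sgnv e₂ • spt (ζ - η))) h
    (by fun_prop)).abs

/-- The Fourier transform of `Bop e₁ e₂ u v` in terms of those of `u` and `v`. -/
def bilinSymb (e₁ e₂ : Bool) (f g : SpaceTime → ℂ) (ζ : SpaceTime) : ℂ :=
  ∫ η, (angleWt e₁ e₂ η (ζ - η) : ℂ) * f η * g (ζ - η)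

lemma continuous_bilinSymb (e₁ e₂ : Bool) (f g : SchwartzMap SpaceTime ℂ) :
    Continuous (bilinSymb e₁ e₂ f g) := by
  obtain ⟨C, hC⟩ := exists_one_add_norm_pow_mul_le g 0
  have hf := f.continuous
  have hg := g.continuous
  refine continuous_iff_continuousAt.mpr fun ζ => ?_
  refine continuousAt_of_dominated (bound := fun η => Real.pi * ‖f η‖ * C)
    (Filter.Eventually.of_forall fun ζ => ?_)
    (Filter.Eventually.of_forall fun ζ => Filter.Eventually.of_forall fun η => ?_)
    ((f.integrable.norm.const_mul _).mul_const _) ?_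
  · have := measurable_angleWt_sub e₁ e₂ ζ
    have hf := hf.measurable
    have hg := hg.measurable
    exact Measurable.aestronglyMeasurable (by fun_prop)
  · rw [norm_mul, norm_mul, Complex.norm_real, Real.norm_eq_abs]
    have := Real.pi_pos
    gcongr
    · exact abs_angleWt_le e₁ e₂ η _
    · simpa using hC (ζ - η)
  · filter_upwards [ae_spt_ne 0, ae_spt_ne (spt ζ)] with η h1 h2
    have h := continuousAt_angleWt_sub e₁ e₂ h1 h2
    exact ((Complex.continuous_ofReal.continuousAt.comp h).mul continuousAt_const).mul
      (by fun_prop)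

lemma lintegral_bilinSymb_le {s l κ b : ℝ} (hl : 0 ≤ l) (hs : l ≤ s) (hκ : 0 < κ)
    (hκ' : κ ≤ 1 / 4) (ha : 1 ≤ s + κ) (hb : 0 ≤ b) (e₀ e₁ e₂ : Bool)
    (f g : SchwartzMap SpaceTime ℂ) :
    ∫⁻ ζ, ENNReal.ofReal ((xWt e₀ l (-κ) ζ * ‖bilinSymb e₁ e₂ f g ζ‖) ^ 2) ≤
      ENNReal.ofReal (symbConst κ l) ^ 2 * (kernelConst (s + κ) b *
        ((∫⁻ η, ENNReal.ofReal ((xWt e₁ s (κ + b) η * ‖f η‖) ^ 2)) *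
          ∫⁻ η, ENNReal.ofReal ((xWt e₂ l (κ + b) η * ‖g η‖) ^ 2))) := by
  set k : SpaceTime → SpaceTime → ENNReal := fun ζ η =>
    ENNReal.ofReal (nullKernel (s + κ) b e₁ e₂ ζ η) with hk
  set u : SpaceTime → ENNReal := fun η => ENNReal.ofReal (xWt e₁ s (κ + b) η * ‖f η‖) with hu
  set v : SpaceTime → ENNReal := fun η => ENNReal.ofReal (xWt e₂ l (κ + b) η * ‖g η‖) with hv
  have hx (e : Bool) (s b : ℝ) (ζ : SpaceTime) := (xWt_pos e s b ζ).le
  have hkm (ζ : SpaceTime) : Measurable (k ζ) := by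
    have := Real.measurable_arccos
    have := measurable_spt
    simp only [hk, nullKernel, InnerProductGeometry.angle]
    fun_prop
  have hxm (e : Bool) (s b : ℝ) := (continuous_xWt e s b).measurable
  have hum : Measurable u := ((hxm _ _ _).mul f.continuous.norm.measurable).ennreal_ofReal
  have hvm : Measurable v := ((hxm _ _ _).mul g.continuous.norm.measurable).ennreal_ofReal
  have hK : ∀ᵐ ζ, ∫⁻ η, k ζ η ^ 2 ≤ kernelConst (s + κ) b := by
    filter_upwards [ae_spt_ne 0] with ζ hζ
    simpa only [hk, ENNReal.ofReal_pow (nullKernel_nonneg _ _ _ _ _ _)] using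
      lintegral_nullKernel_sq_le ha hb e₁ e₂ hζ
  have hsq (e : Bool) (s b : ℝ) (h : SpaceTime → ℂ) (η : SpaceTime) :
      ENNReal.ofReal ((xWt e s b η * ‖h η‖) ^ 2) = ENNReal.ofReal (xWt e s b η * ‖h η‖) ^ 2 :=
    ENNReal.ofReal_pow (mul_nonneg (hx _ _ _ _) (norm_nonneg _)) 2
  have hpt (ζ : SpaceTime) : ENNReal.ofReal (xWt e₀ l (-κ) ζ * ‖bilinSymb e₁ e₂ f g ζ‖) ≤
      ENNReal.ofReal (symbConst κ l) * ∫⁻ η, k ζ η * (u η * v (ζ - η)) := by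
    rw [ENNReal.ofReal_mul (hx _ _ _ _), ofReal_norm,
      ← lintegral_const_mul _ (by fun_prop)]
    refine (mul_le_mul_right (enorm_integral_le_lintegral_enorm _) _).trans ?_
    have hm : Measurable fun η => (angleWt e₁ e₂ η (ζ - η) : ℂ) * f η * g (ζ - η) := by
      have := measurable_angleWt_sub e₁ e₂ ζ
      have := f.continuous.measurable
      have := g.continuous.measurable
      fun_prop
    rw [← lintegral_const_mul _ hm.enorm]
    refine lintegral_mono fun η => ?_
    have h := xWt_mul_angleWt_le b hl hs hκ hκ' e₀ e₁ e₂ ζ η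
    simp only [hk, hu, hv]
    rw [← ofReal_norm, ← ENNReal.ofReal_mul (hx _ _ _ _),
      ← ENNReal.ofReal_mul (mul_nonneg (hx _ _ _ _) (norm_nonneg _)),
      ← ENNReal.ofReal_mul (nullKernel_nonneg _ _ _ _ _ _),
      ← ENNReal.ofReal_mul (symbConst_pos κ l).le]
    refine ENNReal.ofReal_le_ofReal ?_
    rw [norm_mul, norm_mul, Complex.norm_real, Real.norm_eq_abs, angleWt, abs_abs, ← angleWt]
    calc _ = xWt e₀ l (-κ) ζ * angleWt e₁ e₂ η (ζ - η) * (‖f η‖ * ‖g (ζ - η)‖) := by ring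
      _ ≤ symbConst κ l * (nullKernel (s + κ) b e₁ e₂ ζ η *
        (xWt e₁ s (κ + b) η * xWt e₂ l (κ + b) (ζ - η))) * (‖f η‖ * ‖g (ζ - η)‖) := by gcongr
      _ = _ := by ring
  simp only [hsq]
  calc _ ≤ ∫⁻ ζ, ENNReal.ofReal (symbConst κ l) ^ 2 *
          (∫⁻ η, k ζ η * (u η * v (ζ - η))) ^ 2 := by
        refine lintegral_mono fun ζ => ?_
        rw [← mul_pow]
        exact pow_le_pow_left' (hpt ζ) 2
    _ = ENNReal.ofReal (symbConst κ l) ^ 2 *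
          ∫⁻ ζ, (∫⁻ η, k ζ η * (u η * v (ζ - η))) ^ 2 :=
        lintegral_const_mul' _ _ (by simp)
    _ ≤ _ := mul_le_mul_right (lintegral_kernel_sq_le hkm hK hum hvm) _

lemma exists_XsbNorm_eq_rpow {sg : Bool} {s b : ℝ} (hs : 0 ≤ s) (hb : 0 ≤ b)
    (u : SchwartzMap SpaceTime ℂ) :
    ∃ I : ℝ, 0 ≤ I ∧ XsbNorm sg s b ⇑u = I ^ ((1 : ℝ) / 2) ∧
      ∫⁻ ζ, ENNReal.ofReal ((xWt sg s b ζ * ‖𝓕 u ζ‖) ^ 2) = ENNReal.ofReal I := by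
  refine ⟨∫ ζ, (xWt sg s b ζ * ‖𝓕 u ζ‖) ^ 2, integral_nonneg fun ζ => by positivity, ?_, ?_⟩
  · simp only [XsbNorm, wnorm, FT, SchwartzMap.fourier_coe]
  · exact (ofReal_integral_eq_lintegral_ofReal (integrable_xWt_mul_sq sg hs hb (𝓕 u))
      (Filter.Eventually.of_forall fun ζ => by positivity)).symm

lemma XsbNorm_Bop_le {s l κ b : ℝ} (hl : 0 ≤ l) (hs : l ≤ s) (hκ : 0 < κ) (hκ' : κ ≤ 1 / 4)
    (ha : 1 < s + κ) (hb : 1 / 2 < b) (e₀ e₁ e₂ : Bool) (u v : SchwartzMap SpaceTime ℂ) :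
    XsbNorm e₀ l (-κ) (Bop e₁ e₂ u v) ≤
      (symbConst κ l ^ 2 * (kernelConst (s + κ) b).toReal) ^ ((1 : ℝ) / 2) *
        XsbNorm e₁ s (κ + b) u * XsbNorm e₂ l (κ + b) v := by
  have hb0 : 0 ≤ b := by linarith
  obtain ⟨I, hI, hIu, hI'⟩ :=
    exists_XsbNorm_eq_rpow (sg := e₁) (b := κ + b) (hl.trans hs) (by linarith) u
  obtain ⟨J, hJ, hJv, hJ'⟩ := exists_XsbNorm_eq_rpow (sg := e₂) (b := κ + b) hl (by linarith) v
  have h := lintegral_bilinSymb_le hl hs hκ hκ' ha.le hb0 e₀ e₁ e₂ (𝓕 u) (𝓕 v)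
  rw [hI', hJ'] at h
  have hcont := continuous_bilinSymb e₁ e₂ (𝓕 u) (𝓕 v)
  set N := bilinSymb e₁ e₂ (𝓕 u : SchwartzMap SpaceTime ℂ) (𝓕 v : SchwartzMap SpaceTime ℂ)
    with hN
  have hB : Bop e₁ e₂ u v = FTinv N := by
    rw [hN, SchwartzMap.fourier_coe, SchwartzMap.fourier_coe]
    rfl
  have hK := (kernelConst_lt_top ha hb).ne
  generalize kernelConst (s + κ) b = K at *
  have hc := symbConst_pos κ l
  have hfin : ENNReal.ofReal (symbConst κ l) ^ 2 *
      (K * (ENNReal.ofReal I * ENNReal.ofReal J)) ≠ ⊤ :=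
    ENNReal.mul_ne_top (ENNReal.pow_ne_top ENNReal.ofReal_ne_top) (ENNReal.mul_ne_top hK
      (ENNReal.mul_ne_top ENNReal.ofReal_ne_top ENNReal.ofReal_ne_top))
  have hbound : ∫ ζ, (xWt e₀ l (-κ) ζ * ‖FT (Bop e₁ e₂ u v) ζ‖) ^ 2 ≤
      symbConst κ l ^ 2 * K.toReal * I * J := by
    rw [hB]
    refine (Real.le_norm_self _).trans ((norm_integral_le_lintegral_norm _).trans ?_)
    refine (ENNReal.toReal_mono hfin (le_trans (lintegral_mono fun ζ => ?_) h)).trans_eq ?_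
    · refine ENNReal.ofReal_le_ofReal ?_
      rw [Real.norm_of_nonneg (sq_nonneg _)]
      have hx := (xWt_pos e₀ l (-κ) ζ).le
      exact pow_le_pow_left₀ (mul_nonneg hx (norm_nonneg _))
        (mul_le_mul_of_nonneg_left (norm_FT_FTinv_le hcont.continuousAt) hx) 2
    · rw [ENNReal.toReal_mul, ENNReal.toReal_mul, ENNReal.toReal_mul, ENNReal.toReal_pow,
        ENNReal.toReal_ofReal hc.le, ENNReal.toReal_ofReal hI, ENNReal.toReal_ofReal hJ]
      ring
  rw [hIu, hJv, ← Real.mul_rpow (by positivity) hI, ← Real.mul_rpow (by positivity) hJ]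
  exact Real.rpow_le_rpow (integral_nonneg fun ζ => by positivity) hbound (by norm_num)

/-- the null form estimate
`‖B_{±₂,±₁}(A,ψ)‖_{X^{l,-1/4+2ε}_{±}} ≲ ‖A‖_{X^{s,3/4+ε}_{±₂}} ‖ψ‖_{X^{l,3/4+ε}_{±₁}}`. -/
theorem potential_spinor_null_form_estimate (s l : ℝ)
    (h1 : s > 3/4) (h2 : s ≥ l) (h3 : l > 1/4) (h4 : 2*s - l > 3/4) (h5 : 2*s + l > 1) :
    ∃ ε₀ > (0:ℝ), ∀ ε : ℝ, 0 < ε → ε < ε₀ →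
      ∀ sg sg₁ sg₂ : Bool, ∃ C > 0, ∀ A ψ : SchwartzMap SpaceTime ℂ,
        XsbNorm sg l (-(1/4)+2*ε) (Bop sg₂ sg₁ ⇑A ⇑ψ)
          ≤ C * XsbNorm sg₂ s (3/4+ε) ⇑A * XsbNorm sg₁ l (3/4+ε) ⇑ψ := by
  refine ⟨min (1 / 8) ((s - 3 / 4) / 2), lt_min (by norm_num) (by linarith), ?_⟩
  intro ε hε hε' sg sg₁ sg₂
  obtain ⟨hε1, hε2⟩ := lt_min_iff.mp hε'
  set D := (symbConst (1 / 4 - 2 * ε) l ^ 2 *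
    (kernelConst (s + (1 / 4 - 2 * ε)) (1 / 2 + 3 * ε)).toReal) ^ ((1 : ℝ) / 2) with hD
  have hD0 : 0 ≤ D := by positivity
  refine ⟨D + 1, by positivity, fun A ψ => ?_⟩
  have h := XsbNorm_Bop_le (κ := 1 / 4 - 2 * ε) (b := 1 / 2 + 3 * ε) (by linarith) h2
    (by linarith) (by linarith) (by linarith) (by linarith) sg sg₂ sg₁ A ψ
  rw [← hD, show -(1 / 4 - 2 * ε) = -(1 / 4) + 2 * ε by ring,
    show 1 / 4 - 2 * ε + (1 / 2 + 3 * ε) = 3 / 4 + ε by ring] at h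
  have hnn (e : Bool) (r c : ℝ) (u : SpaceTime → ℂ) : 0 ≤ XsbNorm e r c u :=
    Real.rpow_nonneg (integral_nonneg fun ζ => by positivity) _
  have hA := hnn sg₂ s (3 / 4 + ε) A
  have hψ := hnn sg₁ l (3 / 4 + ε) ψ
  refine h.trans ?_
  gcongr
  linarith
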